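/- Let f be a homeomorphism of T² homotopic to the identity such that ρ(f) has nonempty interior, and let f̂ be a lift of f. Then there exists M > 0 such that every continuum K̂ ⊂ ℝ² with diam(K̂) > M satisfies D_{f̂}(K̂) = sup_{j ∈ ℤ} diam(f̂^j(K̂)) = +∞. -/

import Mathlib

open Metric Filter Topology MeasureTheory Set ENNReal

noncomputable section

abbrev R2 : Type := ℝ × ℝ

abbrev Torus : Type := AddCircle (1 : ℝ) × AddCircle (1 : ℝ)

instance : Fact ((0:ℝ) < 1) := ⟨one_pos⟩

/-- The covering projection `ℝ² → T²`. -/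
def proj : R2 → Torus := fun p => ((p.1 : AddCircle (1:ℝ)), (p.2 : AddCircle (1:ℝ)))

/-- `F : ℝ² → ℝ²` is a lift of `f : T² → T²` (commutes with the projection and
with the integer translations). -/
def IsLiftFun (f : Torus → Torus) (F : R2 → R2) : Prop :=
  (∀ x : R2, proj (F x) = f (proj x)) ∧
  ∀ (x : R2) (v : ℤ × ℤ), F (x + ((v.1 : ℝ), (v.2 : ℝ))) = F x + ((v.1 : ℝ), (v.2 : ℝ))

/-- Iteration of a homeomorphism indexed by `ℤ`. -/
def iterZ {X : Type*} [TopologicalSpace X] (F : X ≃ₜ X) : ℤ → X → X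
  | Int.ofNat n => (⇑F)^[n]
  | Int.negSucc n => (⇑F.symm)^[n+1]

/-- The rotation set of a lift. -/
def rotSet (F : R2 ≃ₜ R2) : Set R2 :=
  {v | ∃ (z : ℕ → R2) (n : ℕ → ℕ), Tendsto n atTop atTop ∧
    Tendsto (fun k => ((n k : ℝ))⁻¹ • ((⇑F)^[n k] (z k) - z k)) atTop (nhds v)}

/-- A continuum: a nonempty compact connected set. -/
def IsContinuum {X : Type*} [TopologicalSpace X] (K : Set X) : Prop :=
  IsCompact K ∧ IsConnected K

/-- Dynamical diameter of a set under a homeomorphism of the plane. -/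
def dynDiam (F : R2 ≃ₜ R2) (K : Set R2) : ℝ≥0∞ :=
  ⨆ j : ℤ, EMetric.diam (iterZ F j '' K)

/-- Topological mixing. -/
def TopologicallyMixing {X : Type*} [TopologicalSpace X] (h : X → X) : Prop :=
  ∀ U V : Set X, IsOpen U → IsOpen V → U.Nonempty → V.Nonempty →
    ∃ n₀ : ℕ, ∀ n, n₀ ≤ n → ((h^[n]) '' U ∩ V).Nonempty

/-- Maximal cardinality of a `(±n, ε)`-separated subset of `K`. -/
def sepCount (g : Torus ≃ₜ Torus) (n : ℕ) (ε : ℝ) (K : Set Torus) : ℕ :=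
  sSup {m : ℕ | ∃ Y : Finset Torus, ↑Y ⊆ K ∧ Y.card = m ∧
    ∀ y ∈ Y, ∀ y' ∈ Y, y ≠ y' →
      ∃ i : ℤ, |i| ≤ (n : ℤ) ∧ ε < dist (iterZ g i y) (iterZ g i y')}

/-- The two-sided entropy `h_±(g, K)` carried by `K`. -/
def entropyPM (g : Torus ≃ₜ Torus) (K : Set Torus) : EReal :=
  ⨆ (ε : ℝ) (_ : 0 < ε),
    limsup (fun n : ℕ => ((Real.log (sepCount g n ε K) / n : ℝ) : EReal)) atTop

/-- Connected component of the `ε`-stable set of `z` containing `z`. -/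
def stableComp (G : R2 ≃ₜ R2) (ε : ℝ) (z : R2) : Set R2 :=
  connectedComponentIn {z' : R2 | ∀ j : ℕ, dist ((⇑G)^[j] z') ((⇑G)^[j] z) ≤ ε} z

/-- The stable set of `z`. -/
def stableSet (G : R2 ≃ₜ R2) (z : R2) : Set R2 := ⋃ ε > 0, stableComp G ε z

/-- Connected component of the `ε`-unstable set of `z` containing `z`. -/
def unstableComp (G : R2 ≃ₜ R2) (ε : ℝ) (z : R2) : Set R2 :=
  connectedComponentIn {z' : R2 | ∀ j : ℕ, dist ((⇑G.symm)^[j] z') ((⇑G.symm)^[j] z) ≤ ε} z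

/-- The unstable set of `z`. -/
def unstableSet (G : R2 ≃ₜ R2) (z : R2) : Set R2 := ⋃ ε > 0, unstableComp G ε z

/-- Two points are dynamically related if some dynamically bounded continuum contains both. -/
def dynRel (F : R2 ≃ₜ R2) (z z' : R2) : Prop :=
  ∃ K : Set R2, IsContinuum K ∧ z ∈ K ∧ z' ∈ K ∧ dynDiam F K ≠ ⊤

/-- The equivalence class of `z` under the dynamically-bounded relation. -/
def dynClass (F : R2 ≃ₜ R2) (z : R2) : Set R2 := {z' | dynRel F z z'}


lemma trap_aux (φ : ℝ → ℝ) (hφ : Continuous φ) (a b : ℝ) (t0 : ℝ) (h0 : a < φ t0) (h1 : φ t0 < b)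
    (ha : ∀ t, φ t ≠ a) (hb : ∀ t, φ t ≠ b) (t : ℝ) : a < φ t ∧ φ t < b := by
  constructor
  · by_contra h
    push Not at h
    obtain ⟨x, hx⟩ := mem_range_of_exists_le_of_exists_ge hφ ⟨t, h⟩ ⟨t0, h0.le⟩
    exact ha x hx
  · by_contra h
    push Not at h
    obtain ⟨x, hx⟩ := mem_range_of_exists_le_of_exists_ge hφ ⟨t0, h1.le⟩ ⟨t, h⟩
    exact hb x hx

lemma exists_clog (f : ℝ × ℝ → ℂ) (hf : Continuous f) (h0 : ∀ p, f p ≠ 0) :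
    ∃ L : ℝ × ℝ → ℂ, Continuous L ∧ L (0, 0) = Complex.log (f (0, 0)) ∧
      ∀ p, Complex.exp (L p) = f p := by
  have : SimplyConnectedSpace (ℝ × ℝ) := inferInstance
  have : LocallyPathConnectedSpace (ℝ × ℝ) := inferInstance
  obtain ⟨G, ⟨h1, h2⟩, -⟩ := Complex.isCoveringMapOn_exp.existsUnique_continuousMap_lifts
    (⟨f, hf⟩ : C(ℝ × ℝ, ℂ)) (a₀ := (0, 0)) (e₀ := Complex.log (f (0, 0)))
    (Complex.exp_log (h0 _)) (fun a => by simpa using h0 a)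
  exact ⟨G, G.continuous, h1, fun p => congrFun h2 p⟩

lemma cross_paths (γ σ : ℝ → ℝ × ℝ) (hγ : Continuous γ) (hσ : Continuous σ)
    (hl : ∀ t, (γ 0).1 < (σ t).1) (hr : ∀ t, (σ t).1 < (γ 1).1)
    (hd : ∀ s, (σ 0).2 < (γ s).2) (hu : ∀ s, (γ s).2 < (σ 1).2) :
    ∃ s t, γ s = σ t := by
  by_contra hne
  push Not at hne
  obtain ⟨L, hL, hL0, hexp⟩ := exists_clog
    (fun p => ⟨(γ p.1).1 - (σ p.2).1, (γ p.1).2 - (σ p.2).2⟩)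
    (by
      have : (fun p : ℝ × ℝ => (⟨(γ p.1).1 - (σ p.2).1, (γ p.1).2 - (σ p.2).2⟩ : ℂ))
        = fun p : ℝ × ℝ => (((γ p.1).1 - (σ p.2).1 : ℝ) : ℂ) + (((γ p.1).2 - (σ p.2).2 : ℝ) : ℂ) * Complex.I := by
        funext p
        apply Complex.ext <;> simp
      rw [this]
      fun_prop)
    (by
      intro p hp
      have h1 := congrArg Complex.re hp
      have h2 := congrArg Complex.im hp
      simp at h1 h2
      exact hne p.1 p.2 (Prod.ext (by linarith) (by linarith)))
  have hre : ∀ p, Real.exp (L p).re * Real.cos (L p).im = (γ p.1).1 - (σ p.2).1 := by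
    intro p
    rw [← Complex.exp_re, hexp]
  have him : ∀ p, Real.exp (L p).re * Real.sin (L p).im = (γ p.1).2 - (σ p.2).2 := by
    intro p
    rw [← Complex.exp_im, hexp]
  have cneg : ∀ t, Real.cos (L (0, t)).im < 0 := by
    intro t
    have h := hre (0, t)
    have := hl t
    have hp := Real.exp_pos (L (0, t)).re
    by_contra hc
    push Not at hc
    nlinarith [mul_nonneg hp.le hc]
  have cpos : ∀ t, 0 < Real.cos (L (1, t)).im := by
    intro t
    have h := hre (1, t)
    have := hr t
    have hp := Real.exp_pos (L (1, t)).re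
    by_contra hc
    push Not at hc
    nlinarith [mul_nonneg hp.le (neg_nonneg.2 hc)]
  have spos : ∀ s, 0 < Real.sin (L (s, 0)).im := by
    intro t
    have h := him (t, 0)
    have := hd t
    have hp := Real.exp_pos (L (t, 0)).re
    by_contra hc
    push Not at hc
    nlinarith [mul_nonneg hp.le (neg_nonneg.2 hc)]
  have sneg : ∀ s, Real.sin (L (s, 1)).im < 0 := by
    intro t
    have h := him (t, 1)
    have := hu t
    have hp := Real.exp_pos (L (t, 1)).re
    by_contra hc
    push Not at hc
    nlinarith [mul_nonneg hp.le hc]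
  have pi := Real.pi_pos
  have b1 : -Real.pi < (L (0, 0)).im := by rw [hL0]; exact Complex.neg_pi_lt_log_im _
  have b2 : (L (0, 0)).im ≤ Real.pi := by rw [hL0]; exact Complex.log_im_le_pi _
  have b3 : 0 < (L (0, 0)).im := by
    by_contra hc
    push Not at hc
    have := Real.sin_nonpos_of_nonpos_of_neg_pi_le hc b1.le
    linarith [spos 0]
  have b4 : (L (0, 0)).im < Real.pi := by
    rcases b2.lt_or_eq with h | h
    · exact h
    · have := spos 0
      rw [h] at this
      simp at this
  have b5 : Real.pi / 2 < (L (0, 0)).im := by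
    by_contra hc
    push Not at hc
    have := Real.cos_nonneg_of_neg_pi_div_two_le_of_le (x := (L (0, 0)).im) (by linarith) hc
    linarith [cneg 0]
  have c1 := trap_aux (fun s => (L (s, 0)).im) (by fun_prop) 0 Real.pi 0 b3 b4
    (fun t h => by have := spos t; rw [h] at this; simp at this)
    (fun t h => by have := spos t; rw [h] at this; simp at this) 1
  try simp only at c1
  have c2 : (L (1, 0)).im < Real.pi / 2 := by
    by_contra hc
    push Not at hc
    have := Real.cos_nonpos_of_pi_div_two_le_of_le hc (by linarith)
    linarith [cpos 0]
  have d1 := trap_aux (fun t => (L (1, t)).im) (by fun_prop) (-(Real.pi / 2)) (Real.pi / 2) 0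
    (by try simp only
        linarith) c2
    (fun t h => by have := cpos t; rw [h] at this; simp at this)
    (fun t h => by have := cpos t; rw [h] at this; simp at this) 1
  try simp only at d1
  have d2 : (L (1, 1)).im < 0 := by
    by_contra hc
    push Not at hc
    have := Real.sin_nonneg_of_nonneg_of_le_pi hc (by linarith)
    linarith [sneg 1]
  have e1 := trap_aux (fun s => (L (s, 1)).im) (by fun_prop) (-Real.pi) 0 1
    (by try simp only
        linarith) d2
    (fun t h => by have := sneg t; rw [h] at this; simp at this)
    (fun t h => by have := sneg t; rw [h] at this; simp at this) 0
  try simp only at e1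
  have e2 : (L (0, 1)).im < -(Real.pi / 2) := by
    by_contra hc
    push Not at hc
    have := Real.cos_nonneg_of_neg_pi_div_two_le_of_le (x := (L (0, 1)).im) (by linarith) (by linarith)
    linarith [cneg 1]
  have f2 := mem_range_of_exists_le_of_exists_ge (f := fun t => (L (0, t)).im) (by fun_prop)
    (c := -(Real.pi / 2)) ⟨1, e2.le⟩ ⟨0, by linarith⟩
  obtain ⟨t, ht⟩ := f2
  try simp only at ht
  have := cneg t
  rw [ht] at this
  simp at this

lemma pathConn_thick (S : Set (ℝ × ℝ)) (hS : IsConnected S) (δ : ℝ) (hδ : 0 < δ) :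
    IsPathConnected (thickening δ S) := by
  rw [← IsOpen.isConnected_iff_isPathConnected isOpen_thickening]
  rw [← add_ball_zero]
  have : IsConnected (ball (0 : ℝ × ℝ) δ) :=
    ⟨⟨0, mem_ball_self hδ⟩, (convex_ball _ _).isPreconnected⟩
  rw [← Set.add_image_prod]
  exact (hS.prod this).image _ (by fun_prop)

lemma thick_coord {S : Set (ℝ × ℝ)} {δ : ℝ} {z : ℝ × ℝ} (hz : z ∈ thickening δ S) :
    ∃ w ∈ S, |z.1 - w.1| < δ ∧ |z.2 - w.2| < δ := by
  rw [mem_thickening_iff] at hz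
  obtain ⟨w, hw, h⟩ := hz
  refine ⟨w, hw, ?_, ?_⟩
  · rw [Prod.dist_eq, max_lt_iff] at h; exact h.1
  · rw [Prod.dist_eq, max_lt_iff] at h; exact h.2

lemma cross_sets (Γ S : Set (ℝ × ℝ)) (hΓc : IsCompact Γ) (hSc : IsCompact S)
    (hΓ : IsPreconnected Γ) (hS : IsPreconnected S) (a b p q : ℝ × ℝ)
    (ha : a ∈ Γ) (hb : b ∈ Γ) (hp : p ∈ S) (hq : q ∈ S)
    (h1 : ∀ x ∈ S, a.1 + 1 ≤ x.1) (h2 : ∀ x ∈ S, x.1 + 1 ≤ b.1)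
    (h3 : ∀ g ∈ Γ, p.2 + 1 ≤ g.2) (h4 : ∀ g ∈ Γ, g.2 + 1 ≤ q.2) :
    ∃ x, x ∈ Γ ∧ x ∈ S := by
  by_contra hne
  push Not at hne
  have hdis : Disjoint Γ S := Set.disjoint_left.2 hne
  obtain ⟨δ0, hδ0, hd0⟩ := hdis.exists_thickenings hΓc hSc.isClosed
  set δ := min δ0 (1/2) with hδdef
  have hδ : 0 < δ := by positivity
  have hδ1 : δ ≤ 1/2 := min_le_right _ _
  have hd : Disjoint (thickening δ Γ) (thickening δ S) :=
    hd0.mono (thickening_mono (min_le_left _ _) _) (thickening_mono (min_le_left _ _) _)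
  have jΓ := (pathConn_thick Γ ⟨⟨a, ha⟩, hΓ⟩ δ hδ).joinedIn a (self_subset_thickening hδ _ ha)
    b (self_subset_thickening hδ _ hb)
  have jS := (pathConn_thick S ⟨⟨p, hp⟩, hS⟩ δ hδ).joinedIn p (self_subset_thickening hδ _ hp)
    q (self_subset_thickening hδ _ hq)
  have mΓ : ∀ s, jΓ.somePath.extend s ∈ thickening δ Γ := fun s => by
    exact jΓ.somePath_mem _
  have mS : ∀ s, jS.somePath.extend s ∈ thickening δ S := fun s => by
    exact jS.somePath_mem _
  obtain ⟨s, t, hst⟩ := cross_paths jΓ.somePath.extend jS.somePath.extend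
    (Path.continuous_extend _) (Path.continuous_extend _)
    (fun t => by
      obtain ⟨w, hw, h, -⟩ := thick_coord (mS t)
      have := h1 w hw
      rw [Path.extend_zero]
      rw [abs_lt] at h
      linarith)
    (fun t => by
      obtain ⟨w, hw, h, -⟩ := thick_coord (mS t)
      have := h2 w hw
      rw [Path.extend_one]
      rw [abs_lt] at h
      linarith)
    (fun t => by
      obtain ⟨w, hw, -, h⟩ := thick_coord (mΓ t)
      have := h3 w hw
      rw [Path.extend_zero]
      rw [abs_lt] at h
      linarith)
    (fun t => by
      obtain ⟨w, hw, -, h⟩ := thick_coord (mΓ t)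
      have := h4 w hw
      rw [Path.extend_one]
      rw [abs_lt] at h
      linarith)
  exact Set.disjoint_left.1 hd (mΓ s) (hst ▸ mS t)

/-- image of a ray segment under a continuous map -/
def raySeg (g : R2 → R2) (q d : R2) (T : ℝ) : Set R2 := (fun r : ℝ => g (q + r • d)) '' Icc 0 T

lemma raySeg_compact (g : R2 → R2) (hg : Continuous g) (q d : R2) (T : ℝ) :
    IsCompact (raySeg g q d T) := isCompact_Icc.image (by fun_prop)

lemma raySeg_conn (g : R2 → R2) (hg : Continuous g) (q d : R2) (T : ℝ) :
    IsPreconnected (raySeg g q d T) := isPreconnected_Icc.image _ (by fun_prop)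

lemma raySeg_start (g : R2 → R2) (q d : R2) (T : ℝ) (hT : 0 ≤ T) : g q ∈ raySeg g q d T :=
  ⟨0, ⟨le_refl _, hT⟩, by simp⟩

lemma raySeg_end (g : R2 → R2) (q d : R2) (T : ℝ) (hT : 0 ≤ T) : g (q + T • d) ∈ raySeg g q d T :=
  ⟨T, ⟨hT, le_refl _⟩, rfl⟩

lemma compact_bdd (K : Set R2) (hK : IsCompact K) : ∃ m : ℝ, 0 ≤ m ∧ ∀ z ∈ K, |z.1| ≤ m ∧ |z.2| ≤ m := by
  obtain ⟨m, hm⟩ := hK.isBounded.exists_norm_le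
  refine ⟨max m 0, le_max_right _ _, fun z hz => ?_⟩
  have h1 := hm z hz
  have h2 := norm_fst_le z
  have h3 := norm_snd_le z
  rw [Real.norm_eq_abs] at h2 h3
  exact ⟨(h2.trans h1).trans (le_max_left _ _), (h3.trans h1).trans (le_max_left _ _)⟩

structure LatHom (Λ : Set R2) (G : R2 ≃ₜ R2) (c : ℝ) : Prop where
  comm : ∀ v ∈ Λ, ∀ z, G (z + v) = G z + v
  dense : ∀ t : R2, ∃ v ∈ Λ, |t.1 - v.1| ≤ 1 ∧ |t.2 - v.2| ≤ 1
  bd1 : ∀ z, |(G z).1 - z.1| ≤ c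
  bd2 : ∀ z, |(G z).2 - z.2| ≤ c

lemma LatHom.symm_comm {Λ G c} (h : LatHom Λ G c) : ∀ v ∈ Λ, ∀ z, G.symm (z + v) = G.symm z + v := by
  intro v hv z
  apply G.injective
  rw [h.comm v hv]
  simp

/-- move a point close to a given target by a lattice translation -/
lemma LatHom.translate {Λ G c} (h : LatHom Λ G c) (p t : R2) :
    ∃ p' : R2, |p'.1 - t.1| ≤ 1 ∧ |p'.2 - t.2| ≤ 1 ∧ G p' - p' = G p - p ∧
      p' - G.symm p' = p - G.symm p := by
  obtain ⟨v, hv, h1, h2⟩ := h.dense (t - p)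
  refine ⟨p + v, ?_, ?_, ?_, ?_⟩
  · rw [abs_le] at *
    simp only [Prod.fst_sub, Prod.fst_add] at *
    constructor <;> linarith
  · rw [abs_le] at *
    simp only [Prod.snd_sub, Prod.snd_add] at *
    constructor <;> linarith
  · rw [h.comm v hv]; abel
  · rw [h.symm_comm v hv]; abel

lemma thin_lemma {Λ G c} (hG : LatHom Λ G c) (K : Set R2) (hKc : IsCompact K) (hK : IsPreconnected K)
    (B ℓ h Y0 : ℝ) (hℓ : 4 ≤ ℓ)
    (ha : ∀ z, (G z).1 - z.1 ≤ B)
    (hb : ∀ z, B - ℓ ≤ (G z).1 - z.1 → |(G z).2 - z.2 - Y0| ≤ h)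
    (p0 : R2) (hc1 : B - ℓ / 4 ≤ (G p0).1 - p0.1) (hc2 : B - ℓ / 4 ≤ p0.1 - (G.symm p0).1)
    (hd : ∀ z ∈ K, ∀ w ∈ K, z.1 - (G.symm w).1 < B - ℓ / 4 - 1)
    (he : ∀ z ∈ K, ∀ w ∈ K, (G w).1 - z.1 < B - ℓ / 4 - 1)
    (z z' : R2) (hz : z ∈ K) (hz' : z' ∈ K) (hzz : |z.1 - z'.1| ≤ ℓ / 4) :
    z'.2 - z.2 ≤ 4 * h + 4 := by
  by_contra hgap
  push Not at hgap
  obtain ⟨p, hp1, hp2, hpG, hpS⟩ := hG.translate p0 (z.1, (z.2 + z'.2) / 2)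
  have hc1' : B - ℓ / 4 ≤ (G p).1 - p.1 := by
    have := congrArg Prod.fst hpG; simp at this; linarith
  have hc2' : B - ℓ / 4 ≤ p.1 - (G.symm p).1 := by
    have := congrArg Prod.fst hpS; simp at this; linarith
  simp only [abs_le] at hp1 hp2 hzz
  have hbp := hb p (by linarith)
  have hbs := hb (G.symm p) (by rw [G.apply_symm_apply]; linarith)
  rw [G.apply_symm_apply] at hbs
  obtain ⟨m, hm0, hm⟩ := compact_bdd K hKc
  have hcc : 0 ≤ c := (abs_nonneg _).trans (hG.bd1 p)
  set T := c + m + 1 + |(G.symm p).1| + |(G p).1| with hTdef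
  have hT : 0 ≤ T := by positivity
  set Γ := raySeg G (G.symm p) (-1, 0) T ∪ raySeg G.symm (G p) (1, 0) T with hΓdef
  have hΓc : IsCompact Γ := (raySeg_compact _ G.continuous _ _ _).union
    (raySeg_compact _ G.symm.continuous _ _ _)
  have hΓ : IsPreconnected Γ := by
    refine IsPreconnected.union p ?_ ?_ (raySeg_conn _ G.continuous _ _ _)
      (raySeg_conn _ G.symm.continuous _ _ _)
    · have := raySeg_start G (G.symm p) (-1, 0) T hT
      simpa using this
    · have := raySeg_start G.symm (G p) (1, 0) T hT
      simpa using this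
  obtain ⟨m2, hm20, hm2⟩ := compact_bdd Γ hΓc
  set T2 := m2 + 1 + |z.2| + |z'.2| with hT2def
  have hT2 : 0 ≤ T2 := by positivity
  set S := (K ∪ raySeg id z (0, -1) T2) ∪ raySeg id z' (0, 1) T2 with hSdef
  have hSc : IsCompact S := (hKc.union (raySeg_compact _ continuous_id _ _ _)).union
    (raySeg_compact _ continuous_id _ _ _)
  have hS : IsPreconnected S := by
    refine IsPreconnected.union z' (Or.inl hz') (raySeg_start id z' _ _ hT2) ?_
      (raySeg_conn _ continuous_id _ _ _)
    exact IsPreconnected.union z hz (raySeg_start id z _ _ hT2) hK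
      (raySeg_conn _ continuous_id _ _ _)
  have hSx : ∀ x ∈ S, |x.1| ≤ m := by
    rintro x ((hx | ⟨r, hr, rfl⟩) | ⟨r, hr, rfl⟩)
    · exact (hm x hx).1
    · simpa using (hm z hz).1
    · simpa using (hm z' hz').1
  have hband : ∀ w ∈ Γ, p.1 - ℓ / 2 ≤ w.1 → w.1 ≤ p.1 + ℓ / 2 → |w.2 - p.2| ≤ 2 * h := by
    rintro w (⟨r, hr, rfl⟩ | ⟨r, hr, rfl⟩) h1 h2
    · have k1 := ha (G.symm p + r • (-1, 0))
      have k2 := hb (G.symm p + r • (-1, 0))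
      simp only [Prod.fst_add, Prod.smul_fst, Prod.snd_add, Prod.smul_snd, smul_eq_mul] at *
      have k3 := k2 (by linarith [hr.1])
      rw [abs_le] at *
      constructor <;> linarith
    · have k1 := ha (G.symm (G p + r • (1, 0)))
      have k2 := hb (G.symm (G p + r • (1, 0)))
      rw [G.apply_symm_apply] at k1 k2
      simp only [Prod.fst_add, Prod.smul_fst, Prod.snd_add, Prod.smul_snd, smul_eq_mul] at *
      have k3 := k2 (by linarith [hr.1])
      rw [abs_le] at *
      constructor <;> linarith
  obtain ⟨x, hxΓ, hxS⟩ := cross_sets Γ S hΓc hSc hΓ hS (G (G.symm p + T • (-1, 0)))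
    (G.symm (G p + T • (1, 0))) (z + T2 • (0, -1)) (z' + T2 • (0, 1))
    (Or.inl (raySeg_end _ _ _ _ hT)) (Or.inr (raySeg_end _ _ _ _ hT))
    (Or.inl (Or.inr (raySeg_end id z _ _ hT2))) (Or.inr (raySeg_end id z' _ _ hT2))
    (by
      intro x hx
      have k1 := hG.bd1 (G.symm p + T • (-1, 0))
      have k2 := hSx x hx
      have k3 := le_abs_self (G.symm p).1
      have k4 := abs_nonneg (G p).1
      simp only [Prod.fst_add, Prod.smul_fst, smul_eq_mul, abs_le] at k1 k2 ⊢
      linarith)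
    (by
      intro x hx
      have k1 := hG.bd1 (G.symm (G p + T • (1, 0)))
      have k2 := hSx x hx
      have k3 := neg_abs_le (G p).1
      have k4 := abs_nonneg (G.symm p).1
      rw [G.apply_symm_apply] at k1
      simp only [Prod.fst_add, Prod.smul_fst, smul_eq_mul, abs_le] at k1 k2 ⊢
      linarith)
    (by
      intro x hx
      have k2 := (hm2 x hx).2
      have k3 := le_abs_self z.2
      have k4 := abs_nonneg z'.2
      simp only [Prod.snd_add, Prod.smul_snd, smul_eq_mul, abs_le] at k2 ⊢
      linarith)
    (by
      intro x hx
      have k2 := (hm2 x hx).2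
      have k3 := neg_abs_le z'.2
      have k4 := abs_nonneg z.2
      simp only [Prod.snd_add, Prod.smul_snd, smul_eq_mul, abs_le] at k2 ⊢
      linarith)
  rcases hxS with (hx | ⟨r, hr, rfl⟩) | ⟨r, hr, rfl⟩
  · rcases hxΓ with ⟨r, hr, rfl⟩ | ⟨r, hr, rfl⟩
    · have k := hd z hz _ hx
      simp only [G.symm_apply_apply, Prod.fst_add, Prod.smul_fst, smul_eq_mul] at k
      linarith [hr.1]
    · have k := he z hz _ hx
      simp only [G.apply_symm_apply, Prod.fst_add, Prod.smul_fst, smul_eq_mul] at k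
      linarith [hr.1]
  · have k := hband _ hxΓ (by simp; linarith) (by simp; linarith)
    simp [abs_le] at k
    linarith [hr.1]
  · have k := hband _ hxΓ (by simp; linarith) (by simp; linarith)
    simp [abs_le] at k
    linarith [hr.1]

def Thin (K : Set R2) (h : ℝ) : Prop :=
  ∀ z ∈ K, ∀ z' ∈ K, |z.1 - z'.1| ≤ 1 → z'.2 - z.2 ≤ h

lemma step_vert {Λ G c} (hG : LatHom Λ G c) (K' : Set R2) (hKc : IsCompact K') (hK : IsPreconnected K')
    (p' w1 w2 : R2) (hw1 : w1 ∈ K') (hw2 : w2 ∈ K')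
    (h1 : w1.1 ≤ p'.1 - c - 1) (h2 : p'.1 + c + 1 ≤ w2.1) (σ : ℝ) (hσ : σ = 1 ∨ σ = -1)
    (hup : ∀ r : ℝ, 0 ≤ r → G (p' + r • (0, σ)) ∉ K')
    (hdn : ∀ r : ℝ, 0 ≤ r → G p' + r • (0, -σ) ∉ K') : False := by
  obtain ⟨m, hm0, hm⟩ := compact_bdd K' hKc
  have hcc : 0 ≤ c := (abs_nonneg _).trans (hG.bd1 p')
  set T := m + 1 + c + |p'.2| + |(G p').2| with hTdef
  have hT : 0 ≤ T := by positivity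
  set S := raySeg G p' (0, σ) T ∪ raySeg id (G p') (0, -σ) T with hS
  have hSc : IsCompact S := (raySeg_compact _ G.continuous _ _ _).union
    (raySeg_compact _ continuous_id _ _ _)
  have hSp : IsPreconnected S := IsPreconnected.union (G p') (raySeg_start _ _ _ _ hT)
    (raySeg_start id _ _ _ hT) (raySeg_conn _ G.continuous _ _ _)
    (raySeg_conn _ continuous_id _ _ _)
  have hSx : ∀ x ∈ S, p'.1 - c ≤ x.1 ∧ x.1 ≤ p'.1 + c := by
    rintro x (⟨r, hr, rfl⟩ | ⟨r, hr, rfl⟩)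
    · have := hG.bd1 (p' + r • (0, σ))
      simp [abs_le] at this ⊢
      constructor <;> linarith
    · have := hG.bd1 p'
      simp [abs_le] at this ⊢
      constructor <;> linarith
  have k3 := le_abs_self p'.2
  have k4 := le_abs_self (G p').2
  have k5 := neg_abs_le p'.2
  have k6 := neg_abs_le (G p').2
  have k1 := hG.bd2 (p' + T • (0, σ))
  have k0 := hG.bd2 p'
  simp only [Prod.snd_add, Prod.smul_snd, smul_eq_mul, abs_le] at k1 k0
  have hx1 : ∀ x ∈ S, w1.1 + 1 ≤ x.1 := fun x hx => by linarith [(hSx x hx).1]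
  have hx2 : ∀ x ∈ S, x.1 + 1 ≤ w2.1 := fun x hx => by linarith [(hSx x hx).2]
  have hne : ∀ x, x ∈ K' → x ∈ S → False := by
    rintro x hxK (⟨r, hr, rfl⟩ | ⟨r, hr, rfl⟩)
    · exact hup r hr.1 hxK
    · exact hdn r hr.1 hxK
  have e1 : G (p' + T • (0, σ)) ∈ S := Or.inl (raySeg_end _ _ _ _ hT)
  have e2 : G p' + T • (0, -σ) ∈ S := Or.inr (raySeg_end id _ _ _ hT)
  rcases hσ with rfl | rfl
  · obtain ⟨x, hx1, hx2⟩ := cross_sets K' S hKc hSc hK hSp w1 w2 (G p' + T • (0, -1))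
      (G (p' + T • (0, 1))) hw1 hw2 e2 e1 hx1 hx2
      (by
        intro g hg
        have := (hm g hg).2
        simp only [Prod.snd_add, Prod.smul_snd, smul_eq_mul, abs_le] at this ⊢
        linarith)
      (by
        intro g hg
        have := (hm g hg).2
        simp only [abs_le] at this ⊢
        linarith)
    exact hne x hx1 hx2
  · obtain ⟨x, hx1, hx2⟩ := cross_sets K' S hKc hSc hK hSp w1 w2 
      (G (p' + T • (0, -1))) (G p' + T • (0, - -1)) hw1 hw2 e1 e2 hx1 hx2
      (by
        intro g hg
        have := (hm g hg).2
        simp only [abs_le] at this ⊢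
        linarith)
      (by
        intro g hg
        have := (hm g hg).2
        simp only [Prod.snd_add, Prod.smul_snd, smul_eq_mul, abs_le] at this ⊢
        linarith)
    exact hne x hx1 hx2

lemma step_lemma {Λ G c} (hG : LatHom Λ G c) (K : Set R2) (hKc : IsCompact K) (hK : IsPreconnected K)
    (h : ℝ) (hthin : Thin K h) (hthin' : Thin (G '' K) h) (z p w1 w2 : R2) (hz : z ∈ K)
    (hw1 : w1 ∈ G '' K) (hw2 : w2 ∈ G '' K)
    (h1 : w1.1 ≤ z.1 - c - 2) (h2 : z.1 + c + 2 ≤ w2.1) :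
    ∃ z' ∈ G '' K, z'.1 = z.1 + (G p - p).1 ∧ |z'.2 - z.2 - (G p - p).2| ≤ 2 * h + 5 := by
  have hKc' : IsCompact (G '' K) := hKc.image G.continuous
  have hK' : IsPreconnected (G '' K) := hK.image _ G.continuous.continuousOn
  have hu := hG.bd1 p
  rw [abs_le] at hu
  have hiv := hK'.intermediate_value hw1 hw2 (f := fun x : R2 => x.1) (by fun_prop)
  obtain ⟨z', hz', hzx⟩ := hiv (show z.1 + ((G p).1 - p.1) ∈ Icc w1.1 w2.1 by
    constructor <;> linarith)
  simp only at hzx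
  refine ⟨z', hz', by simpa using hzx, ?_⟩
  have hinj : ∀ q, G q ∈ G '' K → q ∈ K := by
    rintro q ⟨x, hx, hxq⟩
    rwa [← G.injective hxq]
  by_contra hbad
  rw [abs_le, not_and_or] at hbad
  simp only [Prod.snd_sub] at hbad
  rcases hbad with hbad | hbad
  ·
    obtain ⟨p', hp1, hp2, hpG, -⟩ := hG.translate p (z.1, z.2 - h - 2)
    have e1 := congrArg Prod.fst hpG
    have e2 := congrArg Prod.snd hpG
    simp only [Prod.fst_sub, Prod.snd_sub, abs_le] at e1 e2 hp1 hp2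
    refine step_vert hG (G '' K) hKc' hK' p' w1 w2 hw1 hw2 (by linarith) (by linarith) (-1)
      (Or.inr rfl) ?_ ?_
    · intro r hr hmem
      have := hthin _ (hinj _ hmem) z hz (by simp [abs_le]; constructor <;> linarith)
      simp at this
      linarith
    · intro r hr hmem
      have := hthin' _ hz' _ hmem (by simp [abs_le]; constructor <;> linarith)
      simp at this
      linarith
  · obtain ⟨p', hp1, hp2, hpG, -⟩ := hG.translate p (z.1, z.2 + h + 2)
    have e1 := congrArg Prod.fst hpG
    have e2 := congrArg Prod.snd hpG
    simp only [Prod.fst_sub, Prod.snd_sub, abs_le] at e1 e2 hp1 hp2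
    refine step_vert hG (G '' K) hKc' hK' p' w1 w2 hw1 hw2 (by linarith) (by linarith) 1
      (Or.inl rfl) ?_ ?_
    · intro r hr hmem
      have := hthin z hz _ (hinj _ hmem) (by simp [abs_le]; constructor <;> linarith)
      simp at this
      linarith
    · intro r hr hmem
      have := hthin' _ hmem _ hz' (by simp [abs_le]; constructor <;> linarith)
      simp at this
      linarith

lemma chain_lemma {Λ G c} (hG : LatHom Λ G c) (K : Set R2) (hKc : IsCompact K) (hK : IsPreconnected K)
    (N : ℕ) (h : ℝ) (hthin : ∀ k ≤ N, Thin (G^[k] '' K) h) (z0 : R2) (hz0 : z0 ∈ K)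
    (hwide : ∀ k ≤ N, ∃ w1 ∈ G^[k] '' K, ∃ w2 ∈ G^[k] '' K,
      w1.1 ≤ z0.1 - (N + 1) * c - 2 ∧ z0.1 + (N + 1) * c + 2 ≤ w2.1)
    (V : R2) (hV1 : |V.1| ≤ c) (hV2 : |V.2| ≤ c)
    (hV : ∀ S : R2, ∃ p, S.1 * ((G p).1 - p.1 - V.1) + S.2 * ((G p).2 - p.2 - V.2) ≤ 1) :
    ∀ k ≤ N, ∃ z ∈ G^[k] '' K, ∃ S : R2, S.1 ^ 2 + S.2 ^ 2 ≤ k * (8 * c ^ 2 + 2) ∧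
      z.1 = z0.1 + k * V.1 + S.1 ∧ |z.2 - z0.2 - k * V.2 - S.2| ≤ k * (2 * h + 5) ∧
      |z.1 - z0.1| ≤ k * c := by
  have hc : 0 ≤ c := (abs_nonneg _).trans hV1
  intro k
  induction k with
  | zero =>
    intro _
    exact ⟨z0, ⟨z0, hz0, rfl⟩, 0, by simp⟩
  | succ k ih =>
    intro hk
    obtain ⟨z, hz, S, hS, hz1, hz2, hz3⟩ := ih (by omega)
    obtain ⟨p, hp⟩ := hV S
    have himg : G^[k+1] '' K = G '' (G^[k] '' K) := by
      rw [Function.iterate_succ', Set.image_comp]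
    obtain ⟨w1, hw1, w2, hw2, hw11, hw22⟩ := hwide (k+1) hk
    have t1 := hthin k (by omega)
    have t2 := hthin (k+1) hk
    rw [himg] at hw1 hw2 t2 ⊢
    have hkN : ((k:ℝ) + 1) ≤ N := by exact_mod_cast hk
    have hkc : (k + 1) * c ≤ N * c := mul_le_mul_of_nonneg_right hkN hc
    rw [abs_le] at hz3
    obtain ⟨z', hz', e1, e2⟩ := step_lemma hG _ (hKc.image (G.continuous.iterate k))
      (hK.image _ (G.continuous.iterate k).continuousOn) h t1 t2 z p w1 w2 hz hw1 hw2
      (by linarith) (by linarith)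
    have b1 := hG.bd1 p
    have b2 := hG.bd2 p
    simp only [Prod.fst_sub, Prod.snd_sub] at e1 e2
    rw [abs_le] at b1 b2 hV1 hV2 hz2 e2
    refine ⟨z', hz', (S.1 + ((G p).1 - p.1 - V.1), S.2 + ((G p).2 - p.2 - V.2)), ?_, ?_, ?_, ?_⟩
    · push_cast
      have q1 : ((G p).1 - p.1 - V.1) ^ 2 ≤ (2 * c) ^ 2 := sq_le_sq' (by linarith) (by linarith)
      have q2 : ((G p).2 - p.2 - V.2) ^ 2 ≤ (2 * c) ^ 2 := sq_le_sq' (by linarith) (by linarith)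
      nlinarith
    · push_cast
      linarith
    · push_cast
      simp only [abs_le]
      constructor <;> linarith
    · push_cast
      rw [abs_le]
      constructor <;> linarith

lemma final_contra {Λ G c} (hG : LatHom Λ G c) (K : Set R2) (hKc : IsCompact K) (hK : IsPreconnected K)
    (N : ℕ) (h : ℝ) (hthin : ∀ k ≤ N, Thin (G^[k] '' K) h) (z0 : R2) (hz0 : z0 ∈ K)
    (hwide : ∀ k ≤ N, ∃ w1 ∈ G^[k] '' K, ∃ w2 ∈ G^[k] '' K,
      w1.1 ≤ z0.1 - (N + 1) * c - 2 ∧ z0.1 + (N + 1) * c + 2 ≤ w2.1)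
    (V W : R2) (hV1 : |V.1| ≤ c) (hV2 : |V.2| ≤ c) (hW1 : |W.1| ≤ c) (hW2 : |W.2| ≤ c)
    (hV : ∀ S : R2, ∃ p, S.1 * ((G p).1 - p.1 - V.1) + S.2 * ((G p).2 - p.2 - V.2) ≤ 1)
    (hW : ∀ S : R2, ∃ p, S.1 * ((G p).1 - p.1 - W.1) + S.2 * ((G p).2 - p.2 - W.2) ≤ 1)
    (hVW : V.1 = W.1) (Q : ℝ) (hQ0 : 0 ≤ Q) (hQ : N * (8 * c ^ 2 + 2) ≤ Q ^ 2) (ℓ1 h1 : ℝ)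
    (hℓ : 2 * Q ≤ ℓ1)
    (hthin1 : ∀ z ∈ G^[N] '' K, ∀ z' ∈ G^[N] '' K, |z.1 - z'.1| ≤ ℓ1 → z'.2 - z.2 ≤ h1)
    (hbig : h1 + 2 * Q + 2 * N * (2 * h + 5) < N * (V.2 - W.2)) : False := by
  obtain ⟨z, hz, S, hS, e1, e2, -⟩ := chain_lemma hG K hKc hK N h hthin z0 hz0 hwide V hV1 hV2 hV N le_rfl
  obtain ⟨z', hz', S', hS', e1', e2', -⟩ := chain_lemma hG K hKc hK N h hthin z0 hz0 hwide W hW1 hW2 hW N le_rfl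
  have a1 : |S.1| ≤ Q := abs_le_of_sq_le_sq (by nlinarith [sq_nonneg S.2]) hQ0
  have a2 : |S.2| ≤ Q := abs_le_of_sq_le_sq (by nlinarith [sq_nonneg S.1]) hQ0
  have a3 : |S'.1| ≤ Q := abs_le_of_sq_le_sq (by nlinarith [sq_nonneg S'.2]) hQ0
  have a4 : |S'.2| ≤ Q := abs_le_of_sq_le_sq (by nlinarith [sq_nonneg S'.1]) hQ0
  rw [abs_le] at a1 a2 a3 a4 e2 e2'
  have := hthin1 z' hz' z hz (by rw [e1, e1', hVW, abs_le]; constructor <;> linarith)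
  linarith

def dot (a z : R2) : ℝ := a.1 * z.1 + a.2 * z.2

def LatComm (F : R2 ≃ₜ R2) : Prop :=
  ∀ (x : R2) (v : ℤ × ℤ), F (x + ((v.1 : ℝ), (v.2 : ℝ))) = F x + ((v.1 : ℝ), (v.2 : ℝ))

lemma homeo_coe_pow (F : R2 ≃ₜ R2) (n : ℕ) : ⇑(F ^ n) = (⇑F)^[n] := by
  induction n with
  | zero => rfl
  | succ n ih => rw [pow_succ, Function.iterate_succ]; ext1 x; rw [Homeomorph.mul_apply, ih]; rfl

lemma iterZ_eq (F : R2 ≃ₜ R2) (j : ℤ) : iterZ F j = ⇑(F ^ j) := by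
  cases j with
  | ofNat n =>
    rw [Int.ofNat_eq_natCast, zpow_natCast, homeo_coe_pow]; rfl
  | negSucc n =>
    rw [zpow_negSucc, ← inv_pow, homeo_coe_pow]; rfl

lemma LatComm.inv {F : R2 ≃ₜ R2} (h : LatComm F) : LatComm F⁻¹ := by
  intro x v
  apply F.injective
  rw [h]
  have : ∀ y, F (F⁻¹ y) = y := fun y => F.apply_symm_apply y
  rw [this, this]

lemma LatComm.pow {F : R2 ≃ₜ R2} (h : LatComm F) (n : ℕ) : LatComm (F ^ n) := by
  induction n with
  | zero => intro x v; rfl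
  | succ n ih =>
    intro x v
    rw [pow_succ, Homeomorph.mul_apply, Homeomorph.mul_apply, h, ih]

lemma LatComm.zpow {F : R2 ≃ₜ R2} (h : LatComm F) (n : ℤ) : LatComm (F ^ n) := by
  cases n with
  | ofNat n => rw [Int.ofNat_eq_natCast, zpow_natCast]; exact h.pow n
  | negSucc n => rw [zpow_negSucc]; exact (h.pow _).inv

lemma disp_bdd {F : R2 ≃ₜ R2} (h : LatComm F) :
    ∃ c : ℝ, 1 ≤ c ∧ ∀ z, ‖F z - z‖ ≤ c := by
  have hc : IsCompact (Icc (0:ℝ) 1 ×ˢ Icc (0:ℝ) 1) := isCompact_Icc.prod isCompact_Icc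
  obtain ⟨C, hC⟩ := hc.exists_bound_of_continuousOn (f := fun z : R2 => F z - z)
    (by exact (F.continuous.sub continuous_id).continuousOn)
  refine ⟨max C 1, le_max_right _ _, fun z => ?_⟩
  have e : z = (Int.fract z.1, Int.fract z.2) + ((((⌊z.1⌋, ⌊z.2⌋) : ℤ × ℤ).1 : ℝ), (((⌊z.1⌋, ⌊z.2⌋) : ℤ × ℤ).2 : ℝ)) := by
    ext <;> simp
  have k := hC (Int.fract z.1, Int.fract z.2)
    ⟨⟨Int.fract_nonneg _, (Int.fract_lt_one _).le⟩, ⟨Int.fract_nonneg _, (Int.fract_lt_one _).le⟩⟩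
  refine le_trans (le_of_eq ?_) (k.trans (le_max_left _ _))
  congr 1
  conv_lhs => rw [e]
  rw [h]
  abel

lemma disp_pow {F : R2 ≃ₜ R2} {c : ℝ} (hc : ∀ z, ‖F z - z‖ ≤ c) (n : ℕ) (z : R2) :
    ‖(F ^ n) z - z‖ ≤ c * n := by
  induction n with
  | zero => simp
  | succ n ih =>
    rw [pow_succ', Homeomorph.mul_apply]
    push_cast
    have := norm_add_le (F ((F ^ n) z) - (F ^ n) z) ((F ^ n) z - z)
    rw [sub_add_sub_cancel] at this
    linarith [hc ((F ^ n) z)]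

lemma disp_zpow {F : R2 ≃ₜ R2} {c : ℝ} (hc : ∀ z, ‖F z - z‖ ≤ c) (n : ℤ) (z : R2) :
    ‖(F ^ n) z - z‖ ≤ c * |(n:ℝ)| := by
  cases n with
  | ofNat n =>
    rw [Int.ofNat_eq_natCast, zpow_natCast]
    simpa using disp_pow hc n z
  | negSucc n =>
    rw [zpow_negSucc]
    have k := disp_pow hc (n+1) ((F ^ (n+1))⁻¹ z)
    have : (F ^ (n+1)) ((F ^ (n+1))⁻¹ z) = z := (F ^ (n+1)).apply_symm_apply z
    rw [this, norm_sub_rev] at k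
    rw [Int.cast_negSucc, abs_neg, abs_of_nonneg (by positivity)]
    exact_mod_cast k

lemma rotSet_bdd {F : R2 ≃ₜ R2} {c : ℝ} (hc : ∀ z, ‖F z - z‖ ≤ c) (v : R2) (hv : v ∈ rotSet F) :
    ‖v‖ ≤ c := by
  obtain ⟨z, n, hn, ht⟩ := hv
  refine le_of_tendsto ht.norm ?_
  filter_upwards [hn.eventually_ge_atTop 1] with k hk
  have := disp_pow hc (n k) (z k)
  rw [homeo_coe_pow] at this
  rw [norm_smul, norm_inv, Real.norm_natCast]
  have hk' : (0:ℝ) < n k := by exact_mod_cast hk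
  rw [inv_mul_le_iff₀ hk']
  linarith

lemma rot_close {F : R2 ≃ₜ R2} {c : ℝ} (hc : ∀ z, ‖F z - z‖ ≤ c) (ε : ℝ) (hε : 0 < ε) :
    ∃ N : ℕ, ∀ n : ℕ, N ≤ n → ∀ z, ∃ v ∈ rotSet F, ‖(n:ℝ)⁻¹ • ((F ^ n) z - z) - v‖ ≤ ε := by
  by_contra hcon
  push Not at hcon
  choose n hn z hz using hcon
  have hbd : ∀ k, (n (k+1) : ℝ)⁻¹ • ((F ^ n (k+1)) (z (k+1)) - z (k+1)) ∈ closedBall (0 : R2) c := by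
    intro k
    rw [mem_closedBall_zero_iff, norm_smul, norm_inv, Real.norm_natCast]
    have h1 : 1 ≤ n (k+1) := le_trans (by omega) (hn (k+1))
    have hk' : (0:ℝ) < n (k+1) := by exact_mod_cast h1
    rw [inv_mul_le_iff₀ hk']
    have := disp_pow hc (n (k+1)) (z (k+1))
    linarith
  obtain ⟨v, -, φ, hφ, hlim⟩ := (isCompact_closedBall (0 : R2) c).tendsto_subseq hbd
  have hv : v ∈ rotSet F := by
    refine ⟨fun k => z (φ k + 1), fun k => n (φ k + 1), ?_, ?_⟩
    · refine tendsto_atTop_mono (fun k => ?_) tendsto_id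
      have := hφ.id_le k
      have := hn (φ k + 1)
      simp only [id] at *
      omega
    · simpa only [homeo_coe_pow, Function.comp_def] using hlim
  have h2 := (hlim.sub_const v).norm
  rw [sub_self, norm_zero] at h2
  obtain ⟨k, hk⟩ := (h2.eventually_lt_const hε).exists
  have := hz (φ k + 1) v hv
  simp only [Function.comp_def] at hk
  linarith

lemma dot_add (a z w : R2) : dot a (z + w) = dot a z + dot a w := by simp [dot]; ring
lemma dot_sub (a z w : R2) : dot a (z - w) = dot a z - dot a w := by simp [dot]; ring
lemma dot_smul (a z : R2) (r : ℝ) : dot a (r • z) = r * dot a z := by simp [dot]; ring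

lemma dot_bd (a z : R2) : |dot a z| ≤ (|a.1| + |a.2|) * ‖z‖ := by
  have h2 := norm_fst_le z
  have h3 := norm_snd_le z
  rw [Real.norm_eq_abs] at h2 h3
  unfold dot
  calc _ ≤ |a.1 * z.1| + |a.2 * z.2| := abs_add_le _ _
    _ = |a.1| * |z.1| + |a.2| * |z.2| := by rw [abs_mul, abs_mul]
    _ ≤ |a.1| * ‖z‖ + |a.2| * ‖z‖ := by gcongr
    _ = _ := by ring

lemma rot_funct {F : R2 ≃ₜ R2} {c : ℝ} (hc : ∀ z, ‖F z - z‖ ≤ c) (v : R2) (hv : v ∈ rotSet F)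
    (a : R2) (s : ℕ) (hs : 1 ≤ s) (A : ℝ) (hA : A < s * dot a v) :
    ∃ p, A < dot a ((F ^ s) p - p) := by
  by_contra hcon
  push Not at hcon
  have hs' : (0:ℝ) < s := by exact_mod_cast hs
  have hc0 : 0 ≤ c := (norm_nonneg _).trans (hc 0)
  have hq : ∀ q : ℕ, ∀ p, dot a ((F ^ (s * q)) p - p) ≤ q * A := by
    intro q
    induction q with
    | zero => intro p; simp [dot]
    | succ q ih =>
      intro p
      have h1 := ih ((F ^ s) p)
      have h2 := hcon p
      rw [← Homeomorph.mul_apply, ← pow_add] at h1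
      rw [show s * (q + 1) = s * q + s by ring]
      rw [dot_sub] at *
      push_cast
      linarith
  set C := (|a.1| + |a.2|) * (c * s) with hC
  have hm : ∀ m : ℕ, ∀ p, dot a ((F ^ m) p - p) ≤ m * (A / s) + (|A| + C) := by
    intro m p
    have hdm := Nat.div_add_mod m s
    have h1 := hq (m / s) ((F ^ (m % s)) p)
    have h2 := dot_bd a ((F ^ (m % s)) p - p)
    have h3 := disp_pow hc (m % s) p
    have hlt : m % s < s := Nat.mod_lt _ hs
    have hlt' : ((m % s : ℕ) : ℝ) ≤ s := by exact_mod_cast hlt.le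
    rw [← Homeomorph.mul_apply, ← pow_add, hdm] at h1
    have h4 : (|a.1| + |a.2|) * ‖(F ^ (m % s)) p - p‖ ≤ C := by
      rw [hC]
      gcongr
      exact h3.trans (by gcongr)
    have h5 : (m : ℝ) = s * (m / s : ℕ) + (m % s : ℕ) := by exact_mod_cast hdm.symm
    have h6 : ((m / s : ℕ) : ℝ) * A ≤ m * (A / s) + |A| := by
      have : (m:ℝ) * (A / s) = (m / s : ℕ) * A + ((m % s : ℕ) / s) * A := by
        rw [h5]; field_simp
        
      rw [this]
      have h7 : |((m % s : ℕ) / s : ℝ) * A| ≤ 1 * |A| := by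
        rw [abs_mul]
        gcongr
        rw [abs_of_nonneg (by positivity), div_le_one hs']
        exact hlt'
      have := neg_abs_le (((m % s : ℕ) / s : ℝ) * A)
      linarith
    have h8 := le_abs_self (dot a ((F ^ (m % s)) p - p))
    rw [dot_sub] at *
    linarith
  obtain ⟨z, n, hn, ht⟩ := hv
  have hdc : Continuous (dot a) := by unfold dot; fun_prop
  have t1 := (hdc.tendsto v).comp ht
  have t2 : Tendsto (fun k => A / s + (|A| + C) / (n k : ℝ)) atTop (nhds (A / s + 0)) :=
    tendsto_const_nhds.add (Tendsto.div_atTop tendsto_const_nhds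
      (tendsto_natCast_atTop_atTop.comp hn))
  have : dot a v ≤ A / s + 0 := by
    refine le_of_tendsto_of_tendsto t1 t2 ?_
    filter_upwards [hn.eventually_ge_atTop 1] with k hk
    have hk' : (0:ℝ) < n k := by exact_mod_cast hk
    have := hm (n k) (z k)
    rw [homeo_coe_pow] at this
    simp only [Function.comp_def]
    rw [dot_smul, inv_mul_le_iff₀ hk']
    refine this.trans (le_of_eq ?_)
    field_simp
  rw [add_zero, le_div_iff₀ hs'] at this
  linarith

def nrm (z : R2) : ℝ := ‖(⟨z.1, z.2⟩ : ℂ)‖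

lemma nrm_nonneg (z : R2) : 0 ≤ nrm z := norm_nonneg _

lemma nrm_sq (z : R2) : nrm z ^ 2 = z.1 ^ 2 + z.2 ^ 2 := by
  unfold nrm
  rw [Complex.sq_norm, Complex.normSq_apply]
  ring

lemma nrm_add (z w : R2) : nrm (z + w) ≤ nrm z + nrm w :=
  (le_of_eq (by unfold nrm; congr 1)).trans (norm_add_le (⟨z.1, z.2⟩ : ℂ) ⟨w.1, w.2⟩)

lemma nrm_smul (r : ℝ) (z : R2) : nrm (r • z) = |r| * nrm z := by
  unfold nrm
  rw [← Real.norm_eq_abs, ← Complex.norm_real, ← norm_mul]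
  congr 1
  apply Complex.ext <;> simp

lemma nrm_neg (z : R2) : nrm (-z) = nrm z := by
  have := nrm_smul (-1) z
  simpa using this

lemma nrm_le_of_sq {z : R2} {r : ℝ} (hr : 0 ≤ r) (h : z.1 ^ 2 + z.2 ^ 2 ≤ r ^ 2) : nrm z ≤ r := by
  rw [← nrm_sq] at h
  exact abs_le_of_sq_le_sq' h hr |>.2

lemma dot_le (a z : R2) : |dot a z| ≤ nrm a * nrm z := by
  refine abs_le_of_sq_le_sq ?_ (mul_nonneg (nrm_nonneg _) (nrm_nonneg _))
  rw [mul_pow, nrm_sq, nrm_sq]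
  unfold dot
  nlinarith [sq_nonneg (a.1 * z.2 - a.2 * z.1)]

lemma norm_le_nrm (z : R2) : ‖z‖ ≤ nrm z := by
  rw [Prod.norm_def]
  apply max_le
  · rw [Real.norm_eq_abs]
    exact abs_le_of_sq_le_sq (by rw [nrm_sq]; nlinarith [sq_nonneg z.2]) (nrm_nonneg _)
  · rw [Real.norm_eq_abs]
    exact abs_le_of_sq_le_sq (by rw [nrm_sq]; nlinarith [sq_nonneg z.1]) (nrm_nonneg _)

lemma nrm_le_norm (z : R2) : nrm z ≤ 2 * ‖z‖ := by
  have h2 := norm_fst_le z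
  have h3 := norm_snd_le z
  rw [Real.norm_eq_abs] at h2 h3
  have h4 := sq_le_sq' (by linarith [neg_abs_le z.1]) ((le_abs_self z.1).trans h2)
  have h5 := sq_le_sq' (by linarith [neg_abs_le z.2]) ((le_abs_self z.2).trans h3)
  apply nrm_le_of_sq (by positivity)
  nlinarith [sq_nonneg ‖z‖]

lemma exists_perp (a b : R2) : ∃ g : R2, g.1 ^ 2 + g.2 ^ 2 = 1 ∧ dot g a = 0 ∧ dot g b ≤ 0 := by
  have key : ∃ g : R2, g.1 ^ 2 + g.2 ^ 2 = 1 ∧ dot g a = 0 := by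
    by_cases ha : nrm a = 0
    · have h := nrm_sq a
      rw [ha] at h
      have h1 : a.1 = 0 := by nlinarith [sq_nonneg a.1, sq_nonneg a.2]
      have h2 : a.2 = 0 := by nlinarith [sq_nonneg a.1, sq_nonneg a.2]
      exact ⟨(1, 0), by norm_num, by simp [dot, h1]⟩
    · refine ⟨(- a.2 / nrm a, a.1 / nrm a), ?_, ?_⟩
      · have h := nrm_sq a
        field_simp
        linarith
      · simp only [dot]
        field_simp
        ring
  obtain ⟨g, h1, h2⟩ := key
  rcases le_total (dot g b) 0 with h | h
  · exact ⟨g, h1, h2, h⟩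
  · refine ⟨-g, by simpa using h1, ?_, ?_⟩
    · simp only [dot, Prod.fst_neg, Prod.snd_neg] at *; linarith
    · simp only [dot, Prod.fst_neg, Prod.snd_neg] at *; linarith

lemma exists_f (σ : ℝ) (hσ : 0 < σ) (hσ1 : σ ≤ 1) (a b d : R2) :
    ∃ f : R2, 1 ≤ nrm f ∧ nrm f ≤ 2 ∧ dot f a ≤ σ * nrm a ∧ dot f b ≤ σ * nrm b ∧
      σ / 4 * nrm d ≤ |dot f d| := by
  obtain ⟨g, hg, hga, hgb⟩ := exists_perp a b
  have hng : nrm g = 1 := by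
    have := nrm_sq g
    rw [hg] at this
    nlinarith [nrm_nonneg g]
  have na := nrm_nonneg a
  have nb := nrm_nonneg b
  have nd := nrm_nonneg d
  by_cases hd : σ / 4 * nrm d ≤ |dot g d|
  · exact ⟨g, hng.ge, by linarith, by rw [hga]; positivity, hgb.trans (by positivity), hd⟩
  push Not at hd
  set k : R2 := (-g.2, g.1) with hk
  have hnk : nrm k = 1 := by
    have := nrm_sq k
    simp only [hk] at this
    nlinarith [nrm_nonneg k]
  have hf : ∀ x, dot (g + σ • k) x = dot g x + σ * dot k x := by
    intro x; simp [dot, hk]; ring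
  have hnf := nrm_sq (g + σ • k)
  simp only [hk, Prod.fst_add, Prod.snd_add, Prod.smul_fst, Prod.smul_snd, smul_eq_mul] at hnf
  have hnf' : nrm (g + σ • k) ^ 2 = 1 + σ ^ 2 := by
    rw [hk, hnf]; linear_combination (1 + σ ^ 2) * hg
  have hnn := nrm_nonneg (g + σ • k)
  refine ⟨g + σ • k, ?_, ?_, ?_, ?_, ?_⟩
  · nlinarith
  · nlinarith
  · rw [hf, hga]
    have := (abs_le.1 (dot_le k a)).2
    rw [hnk] at this
    nlinarith
  · rw [hf]
    have := (abs_le.1 (dot_le k b)).2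
    rw [hnk] at this
    nlinarith
  · rw [hf]
    have hsum : dot g d ^ 2 + dot k d ^ 2 = nrm d ^ 2 := by
      rw [nrm_sq]; simp only [dot, hk]
      linear_combination (d.1 ^ 2 + d.2 ^ 2) * hg
    have h1 : nrm d / 2 ≤ |dot k d| := by
      by_contra hcon
      push Not at hcon
      have q1 : |dot g d| < nrm d / 2 := by nlinarith
      have q2 := sq_lt_sq' (by linarith [abs_nonneg (dot g d)]) q1
      have q3 := sq_lt_sq' (by linarith [abs_nonneg (dot k d)]) hcon
      rw [sq_abs] at q2 q3
      nlinarith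
    have h2 : |σ * dot k d| ≤ |dot g d + σ * dot k d| + |dot g d| := by
      have := abs_sub (dot g d + σ * dot k d) (dot g d)
      rwa [add_sub_cancel_left] at this
    rw [abs_mul, abs_of_pos hσ] at h2
    nlinarith

lemma selection (P : Set R2) (v0 : R2) (C η : ℝ) (hC : 1 ≤ C) (hη : 0 < η) (hη1 : η ≤ C)
    (hne : P.Nonempty)
    (hP : ∀ v ∈ P, nrm (v - v0) ≤ C) :
    ∃ κ Rm : ℝ, 0 < κ ∧ κ ≤ 1 ∧ 1 ≤ Rm ∧ ∀ a b d : R2, nrm a ≤ C → nrm b ≤ C → ∀ ε : ℝ, 0 < ε →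
      ∃ (q e u : R2) (R : ℝ), u ∈ P ∧ e.1 ^ 2 + e.2 ^ 2 = 1 ∧ 0 < R ∧ R ≤ Rm ∧ u = q + R • e ∧
        (∀ v ∈ P, nrm (v - q) ≤ R + ε) ∧ dot e a ≤ η / 2 ∧ dot e b ≤ η / 2 ∧
        κ * nrm d ≤ |dot e d| := by
  set σ := η / (4 * C) with hσd
  have hσ : 0 < σ := by positivity
  have hσ1 : σ ≤ 1 := by rw [hσd, div_le_one (by positivity)]; linarith
  have hσC : σ * C = η / 4 := by rw [hσd]; field_simp
  set L := 4 / η * (C ^ 2 + η * C) + 8 * C / σ + 2 * C with hL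
  have t1 : 0 < 4 / η * (C ^ 2 + η * C) := by positivity
  have t2 : 0 < 8 * C / σ := by positivity
  have hL1 : C ^ 2 + η * C ≤ L * η / 4 := by
    have : 4 / η * (C ^ 2 + η * C) * η / 4 = C ^ 2 + η * C := by field_simp
    rw [← this]
    gcongr
    linarith
  have hL2 : 8 * C ≤ L * σ := by
    have : 8 * C / σ * σ = 8 * C := by field_simp
    rw [← this]
    gcongr
    linarith
  have hL3 : 2 * C ≤ L := by linarith
  have hL0 : 0 < L := by linarith
  refine ⟨σ / 24, 3 * L, by positivity, by linarith, by linarith, ?_⟩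
  intro a b d ha hb ε hε
  obtain ⟨f, hf1, hf2, hfa, hfb, hfd⟩ := exists_f σ hσ hσ1 a b d
  set q := v0 - L • f with hq
  have hLf : nrm (L • f) = L * nrm f := by rw [nrm_smul, abs_of_pos hL0]
  have hbound : ∀ v ∈ P, nrm (v - q) ≤ 3 * L := by
    intro v hv
    have h1 := nrm_add (v - v0) (L • f)
    have : v - v0 + L • f = v - q := by rw [hq]; abel
    rw [this, hLf] at h1
    nlinarith [hP v hv]
  have hlow : ∀ v ∈ P, L - C ≤ nrm (v - q) := by
    intro v hv
    have h1 := nrm_add (v - q) (-(v - v0))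
    have : v - q + -(v - v0) = L • f := by rw [hq]; abel
    rw [this, hLf, nrm_neg] at h1
    nlinarith [hP v hv]
  set I := (fun v => nrm (v - q)) '' P with hI
  have hIb : BddAbove I := ⟨3 * L, by rintro _ ⟨v, hv, rfl⟩; exact hbound v hv⟩
  obtain ⟨_, ⟨u, hu, rfl⟩, hlt⟩ := exists_lt_of_lt_csSup (hne.image _) (show sSup I - ε < sSup I by linarith)
  have hR0 : 0 < nrm (u - q) := by linarith [hlow u hu]
  set R := nrm (u - q) with hR
  have hRinv : 0 < R⁻¹ := by positivity
  have hdot : ∀ x, dot (R⁻¹ • (u - q)) x = R⁻¹ * (L * dot f x + dot (u - v0) x) := by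
    intro x; simp [dot, hq]; ring
  have hlowu := hlow u hu
  have hPu := hP u hu
  have hab : ∀ x, nrm x ≤ C → dot f x ≤ σ * nrm x → dot (R⁻¹ • (u - q)) x ≤ η / 2 := by
    intro x hx hfx
    rw [hdot, inv_mul_le_iff₀ hR0]
    have h1 := (abs_le.1 (dot_le (u - v0) x)).2
    have h2 : nrm (u - v0) * nrm x ≤ C * C := by
      apply mul_le_mul hPu hx (nrm_nonneg _) (by linarith)
    have h3 : dot f x ≤ η / 4 := by rw [← hσC]; exact hfx.trans (by gcongr)
    nlinarith
  refine ⟨q, R⁻¹ • (u - q), u, R, hu, ?_, hR0, hbound u hu, ?_, ?_, hab a ha hfa, hab b hb hfb, ?_⟩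
  · rw [← nrm_sq, nrm_smul, abs_of_pos hRinv, ← hR]
    field_simp
  · rw [smul_smul, mul_inv_cancel₀ hR0.ne', one_smul]; abel
  · intro v hv
    have := le_csSup hIb (show nrm (v - q) ∈ I from ⟨v, hv, rfl⟩)
    linarith
  · rw [hdot, abs_mul, abs_of_pos hRinv, le_inv_mul_iff₀ hR0]
    have h1 := dot_le (u - v0) d
    have nd := nrm_nonneg d
    have h2 : nrm (u - v0) * nrm d ≤ C * nrm d := by gcongr
    have h3 : |L * dot f d| ≤ |L * dot f d + dot (u - v0) d| + |dot (u - v0) d| := by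
      have := abs_sub (L * dot f d + dot (u - v0) d) (dot (u - v0) d)
      rwa [add_sub_cancel_right] at this
    rw [abs_mul, abs_of_pos hL0] at h3
    have h4 : L * (σ / 4 * nrm d) ≤ L * |dot f d| := by gcongr
    have h5 : R * (σ / 24 * nrm d) ≤ (3 * L) * (σ / 24 * nrm d) := by
      gcongr
      exact hbound u hu
    have h6 : 8 * C * nrm d ≤ L * σ * nrm d := by gcongr
    linarith

def perp (e : R2) : R2 := (-e.2, e.1)

def rotH (e : R2) (he : e.1 ^ 2 + e.2 ^ 2 = 1) : R2 ≃ₜ R2 where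
  toFun z := (dot e z, dot (perp e) z)
  invFun w := (e.1 * w.1 - e.2 * w.2, e.2 * w.1 + e.1 * w.2)
  left_inv z := by
    ext
    · simp only [dot, perp]; linear_combination z.1 * he
    · simp only [dot, perp]; linear_combination z.2 * he
  right_inv z := by
    ext
    · simp only [dot]; linear_combination z.1 * he
    · simp only [dot, perp]; linear_combination z.2 * he
  continuous_toFun := by unfold dot; fun_prop
  continuous_invFun := by fun_prop

lemma rotH_apply (e he z) : rotH e he z = (dot e z, dot (perp e) z) := rfl

lemma rotH_add (e he z w) : rotH e he (z + w) = rotH e he z + rotH e he w := by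
  simp [rotH_apply, dot_add]

lemma conj_apply (ρ H : R2 ≃ₜ R2) (z : R2) : (ρ * H * ρ⁻¹) (ρ z) = ρ (H z) := by
  rw [Homeomorph.mul_apply, Homeomorph.mul_apply]
  congr 2
  exact ρ.symm_apply_apply z

lemma conj_symm_apply (ρ H : R2 ≃ₜ R2) (z : R2) : (ρ * H * ρ⁻¹).symm (ρ z) = ρ (H.symm z) := by
  rw [Homeomorph.symm_apply_eq, conj_apply, H.apply_symm_apply]

lemma unit_abs {e : R2} (he : e.1 ^ 2 + e.2 ^ 2 = 1) : |e.1| ≤ 1 ∧ |e.2| ≤ 1 := by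
  constructor
  · exact abs_le_of_sq_le_sq (by nlinarith [sq_nonneg e.2]) (by norm_num)
  · exact abs_le_of_sq_le_sq (by nlinarith [sq_nonneg e.1]) (by norm_num)

lemma perp_unit {e : R2} (he : e.1 ^ 2 + e.2 ^ 2 = 1) : (perp e).1 ^ 2 + (perp e).2 ^ 2 = 1 := by
  simp only [perp]; linarith

lemma dot_unit_le {e : R2} (he : e.1 ^ 2 + e.2 ^ 2 = 1) (z : R2) : |dot e z| ≤ 2 * ‖z‖ := by
  have h := unit_abs he
  refine (dot_bd e z).trans ?_
  have := norm_nonneg z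
  nlinarith

lemma rotLat (e : R2) (he : e.1 ^ 2 + e.2 ^ 2 = 1) (H : R2 ≃ₜ R2) (hH : LatComm H) (b : ℝ)
    (hb : ∀ z, ‖H z - z‖ ≤ b) :
    LatHom (Set.range fun v : ℤ × ℤ => rotH e he ((v.1 : ℝ), (v.2 : ℝ)))
      (rotH e he * H * (rotH e he)⁻¹) (2 * b) := by
  have surj : ∀ w, ∃ z, w = rotH e he z := fun w => ⟨(rotH e he).symm w, by simp⟩
  constructor
  · rintro _ ⟨v, rfl⟩ w
    obtain ⟨z, rfl⟩ := surj w
    simp only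
    rw [← rotH_add, conj_apply, conj_apply, hH, rotH_add]
  · intro t
    obtain ⟨z, rfl⟩ := surj t
    refine ⟨_, ⟨(round z.1, round z.2), rfl⟩, ?_⟩
    have h1 := abs_sub_round z.1
    have h2 := abs_sub_round z.2
    have hn : ‖z - ((round z.1 : ℝ), (round z.2 : ℝ))‖ ≤ 1 / 2 := by
      rw [Prod.norm_def]
      exact max_le h1 h2
    have k1 := dot_unit_le he (z - ((round z.1 : ℝ), (round z.2 : ℝ)))
    have k2 := dot_unit_le (perp_unit he) (z - ((round z.1 : ℝ), (round z.2 : ℝ)))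
    rw [dot_sub] at k1 k2
    simp only [rotH_apply]
    constructor <;> linarith
  · intro w
    obtain ⟨z, rfl⟩ := surj w
    rw [conj_apply]
    simp only [rotH_apply]
    rw [← dot_sub]
    exact (dot_unit_le he _).trans (by linarith [hb z])
  · intro w
    obtain ⟨z, rfl⟩ := surj w
    rw [conj_apply]
    simp only [rotH_apply]
    rw [← dot_sub]
    exact (dot_unit_le (perp_unit he) _).trans (by linarith [hb z])

lemma nrm_rot (e : R2) (he : e.1 ^ 2 + e.2 ^ 2 = 1) (z : R2) :
    dot e z ^ 2 + dot (perp e) z ^ 2 = nrm z ^ 2 := by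
  rw [nrm_sq]; simp only [dot, perp]
  linear_combination (z.1 ^ 2 + z.2 ^ 2) * he

lemma thin_rot {F : R2 ≃ₜ R2} (hF : LatComm F) {c : ℝ} (hc : ∀ z, ‖F z - z‖ ≤ c)
    (e : R2) (he : e.1 ^ 2 + e.2 ^ 2 = 1) (q u : R2) (R ε T : ℝ) (hT0 : 0 ≤ T) (hTdef : T = R + 2 * ε)
    (hu : u ∈ rotSet F) (huq : u = q + R • e) (n : ℕ) (hn : 1 ≤ n)
    (hT : ∀ z, nrm ((n:ℝ)⁻¹ • ((F ^ n) z - z) - q) ≤ T)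
    (l θ : ℝ) (hθ : 0 ≤ θ) (hlθ : 2 * T * l ≤ θ ^ 2) (hl4 : 4 ≤ l * n)
    (hεn : 4 * ε * n + 1 ≤ l * n / 4)
    (K : Set R2) (hKc : IsCompact K) (hK : IsPreconnected K)
    (hd : ∀ z ∈ K, ∀ w ∈ K, dot e z - dot e ((F ^ n).symm w) < n * (dot e q + T) - l * n / 4 - 1)
    (hee : ∀ z ∈ K, ∀ w ∈ K, dot e ((F ^ n) w) - dot e z < n * (dot e q + T) - l * n / 4 - 1)
    (z z' : R2) (hz : z ∈ K) (hz' : z' ∈ K) (hzz : |dot e z - dot e z'| ≤ l * n / 4) :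
    dot (perp e) z' - dot (perp e) z ≤ 4 * (θ * n) + 4 := by
  have hn' : (0:ℝ) < n := by exact_mod_cast hn
  set ρ := rotH e he with hρ
  have surj : ∀ w, ∃ z, w = ρ z := fun w => ⟨ρ.symm w, by simp⟩
  have ρ1 : ∀ z, (ρ z).1 = dot e z := fun z => rfl
  have ρ2 : ∀ z, (ρ z).2 = dot (perp e) z := fun z => rfl
  have hdisp : ∀ z, (dot e ((F ^ n) z) - dot e z - n * dot e q) ^ 2 +
      (dot (perp e) ((F ^ n) z) - dot (perp e) z - n * dot (perp e) q) ^ 2 ≤ (n * T) ^ 2 := by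
    intro z
    have h1 := nrm_rot e he ((n:ℝ)⁻¹ • ((F ^ n) z - z) - q)
    have h2 := hT z
    have h3 : nrm ((n:ℝ)⁻¹ • ((F ^ n) z - z) - q) ^ 2 ≤ T ^ 2 := by
      gcongr
      exact nrm_nonneg _
    rw [← h1] at h3
    simp only [dot_sub, dot_smul] at h3
    have h4 : (n:ℝ)^2 * (((n:ℝ)⁻¹ * (dot e ((F ^ n) z) - dot e z) - dot e q) ^ 2 +
      ((n:ℝ)⁻¹ * (dot (perp e) ((F ^ n) z) - dot (perp e) z) - dot (perp e) q) ^ 2) ≤ (n:ℝ)^2 * T ^ 2 := by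
      gcongr
    rw [mul_pow]
    refine le_trans (le_of_eq ?_) h4
    field_simp
  have hdisp1 : ∀ z, dot e ((F ^ n) z) - dot e z ≤ n * (dot e q + T) := by
    intro z
    have h1 := hdisp z
    have h2 : (dot e ((F ^ n) z) - dot e z - n * dot e q) ^ 2 ≤ (n * T) ^ 2 := by
      nlinarith [sq_nonneg (dot (perp e) ((F ^ n) z) - dot (perp e) z - n * dot (perp e) q)]
    have := (abs_le_of_sq_le_sq' h2 (by positivity)).2
    linarith
  obtain ⟨p', hp'⟩ := rot_funct hc u hu e (2 * n) (by omega) ((2 * n : ℕ) * dot e u - 1) (by linarith)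
  have hue : dot e u = dot e q + R := by
    rw [huq, dot_add, dot_smul]
    have : dot e e = 1 := by simp only [dot]; linarith
    rw [this, mul_one]
  rw [two_mul, pow_add, Homeomorph.mul_apply, dot_sub, hue] at hp'
  push_cast at hp'
  have hA := hdisp1 p'
  have hB := hdisp1 ((F ^ n) p')
  have key := thin_lemma (rotLat e he (F ^ n) (hF.pow n) (c * n) (disp_pow hc n)) (ρ '' K)
    (hKc.image ρ.continuous) (hK.image _ ρ.continuous.continuousOn)
    (n * (dot e q + T)) (l * n) (θ * n) (n * dot (perp e) q) hl4
    (by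
      intro w
      obtain ⟨z, rfl⟩ := surj w
      rw [conj_apply, ρ1, ρ1]
      exact hdisp1 z)
    (by
      intro w
      obtain ⟨z, rfl⟩ := surj w
      rw [conj_apply, ρ1, ρ1, ρ2, ρ2]
      intro h
      have h1 := hdisp z
      apply abs_le_of_sq_le_sq _ (by positivity)
      set x := dot e ((F ^ n) z) - dot e z - n * dot e q with hx
      have hx1 : n * (T - l) ≤ x := by rw [hx]; linarith
      have hx2 : 2 * (n * T) * x - (n * T) ^ 2 ≤ x ^ 2 := by nlinarith [sq_nonneg (x - n * T)]
      have hx3 : 2 * (n * T) * (n * (T - l)) ≤ 2 * (n * T) * x := by gcongr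
      have hx4 : (n:ℝ) ^ 2 * (2 * T * l) ≤ n ^ 2 * θ ^ 2 := by gcongr
      linarith)
    (ρ ((F ^ n) p'))
    (by
      rw [conj_apply, ρ1, ρ1]
      rw [hTdef] at hA ⊢
      linarith)
    (by
      rw [conj_symm_apply, ρ1, ρ1, (F ^ n).symm_apply_apply]
      rw [hTdef] at hB ⊢
      linarith)
    (by
      rintro _ ⟨z, hz, rfl⟩ _ ⟨w, hw, rfl⟩
      rw [conj_symm_apply, ρ1, ρ1]
      exact hd z hz w hw)
    (by
      rintro _ ⟨z, hz, rfl⟩ _ ⟨w, hw, rfl⟩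
      rw [conj_apply, ρ1, ρ1]
      exact hee z hz w hw)
    (ρ z) (ρ z') ⟨z, hz, rfl⟩ ⟨z', hz', rfl⟩ hzz
  exact key

lemma final_rot {F : R2 ≃ₜ R2} (hF : LatComm F) {c : ℝ} (hc1 : 1 ≤ c) (hc : ∀ z, ‖F z - z‖ ≤ c)
    (e : R2) (he : e.1 ^ 2 + e.2 ^ 2 = 1) (v0 : R2) (η : ℝ) (hη : 0 < η)
    (hball : ∀ w, nrm w ≤ η → v0 + w ∈ rotSet F)
    (K : Set R2) (hKc : IsCompact K) (hK : IsPreconnected K) (r s N : ℕ) (hr : 1 ≤ r) (hs : 1 ≤ s)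
    (hN : N = r ^ 2) (h ℓ1 h1 : ℝ)
    (hthin : ∀ k ≤ N, ∀ z ∈ K, ∀ z' ∈ K,
      |dot e ((F ^ (s * k)) z) - dot e ((F ^ (s * k)) z')| ≤ 1 →
      dot (perp e) ((F ^ (s * k)) z') - dot (perp e) ((F ^ (s * k)) z) ≤ h)
    (z0 z1 z2 : R2) (hz0 : z0 ∈ K) (hz1 : z1 ∈ K) (hz2 : z2 ∈ K)
    (hw1 : dot e z1 ≤ dot e z0 - 6 * c * N * s - 2) (hw2 : dot e z0 + 6 * c * N * s + 2 ≤ dot e z2)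
    (hℓ : 12 * r * c * s ≤ ℓ1)
    (hthin1 : ∀ z ∈ K, ∀ z' ∈ K,
      |dot e ((F ^ (s * N)) z) - dot e ((F ^ (s * N)) z')| ≤ ℓ1 →
      dot (perp e) ((F ^ (s * N)) z') - dot (perp e) ((F ^ (s * N)) z) ≤ h1)
    (hbig : h1 + 12 * r * c * s + 2 * N * (2 * h + 5) < 2 * η * (N * s)) : False := by
  have hs' : (1:ℝ) ≤ s := by exact_mod_cast hs
  have hr' : (1:ℝ) ≤ r := by exact_mod_cast hr
  have hNr : (N:ℝ) = (r:ℝ) ^ 2 := by exact_mod_cast hN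
  have hN1 : (1:ℝ) ≤ N := by rw [hNr]; nlinarith
  have hcs : 1 ≤ c * s := by nlinarith
  set ρ := rotH e he with hρ
  have ρ1 : ∀ z, (ρ z).1 = dot e z := fun z => rfl
  have ρ2 : ∀ z, (ρ z).2 = dot (perp e) z := fun z => rfl
  have surj : ∀ w, ∃ z, w = ρ z := fun w => ⟨ρ.symm w, by simp⟩
  set G := ρ * (F ^ s) * ρ⁻¹ with hG
  have hit : ∀ k z, G^[k] (ρ z) = ρ ((F ^ (s * k)) z) := by
    intro k z
    rw [← homeo_coe_pow, hG, conj_pow, conj_apply, pow_mul]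
  have himg : ∀ k, G^[k] '' (ρ '' K) = (fun z => ρ ((F ^ (s * k)) z)) '' K := by
    intro k
    rw [← Set.image_comp]
    apply Set.image_congr
    intro z _
    exact hit k z
  have hL : LatHom _ G (2 * (c * s)) := rotLat e he (F ^ s) (hF.pow s) (c * s) (disp_pow hc s)
  have hrb : ∀ (g : R2) (_ : g.1 ^ 2 + g.2 ^ 2 = 1) (v : R2), v ∈ rotSet F → |s * dot g v| ≤ 2 * (c * s) := by
    intro g hg v hv
    rw [abs_mul, abs_of_nonneg (by positivity)]
    have h1 := dot_unit_le hg v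
    have h2 := rotSet_bdd hc v hv
    nlinarith
  have hVV : ∀ v ∈ rotSet F, ∀ S : R2, ∃ p, S.1 * ((G p).1 - p.1 - s * dot e v) +
      S.2 * ((G p).2 - p.2 - s * dot (perp e) v) ≤ 1 := by
    intro v hv S
    obtain ⟨p, hp⟩ := rot_funct hc v hv (-(S.1 • e + S.2 • perp e)) s hs
      (s * dot (-(S.1 • e + S.2 • perp e)) v - 1) (by linarith)
    refine ⟨ρ p, ?_⟩
    rw [hG, conj_apply, ρ1, ρ1, ρ2, ρ2]
    have hdd : ∀ x, dot (-(S.1 • e + S.2 • perp e)) x = - (S.1 * dot e x + S.2 * dot (perp e) x) := by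
      intro x; simp [dot, perp]; ring
    rw [hdd, hdd, dot_sub, dot_sub] at hp
    nlinarith
  have hpe : nrm (η • perp e) ≤ η := by
    rw [nrm_smul, abs_of_pos hη]
    have : nrm (perp e) ≤ 1 := nrm_le_of_sq (by norm_num) (by rw [perp_unit he]; norm_num)
    nlinarith
  have m1 := hball (η • perp e) hpe
  have m2 := hball (-(η • perp e)) (by rwa [nrm_neg])
  have dd1 : dot e (perp e) = 0 := by simp only [dot, perp]; ring
  have dd2 : dot (perp e) (perp e) = 1 := by simp only [dot, perp]; linarith
  have dn : ∀ a x : R2, dot a (-x) = - dot a x := by intro a x; simp [dot]; ring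
  refine final_contra hL (ρ '' K) (hKc.image ρ.continuous) (hK.image _ ρ.continuous.continuousOn)
    N h ?_ (ρ z0) ⟨z0, hz0, rfl⟩ ?_
    (s * dot e (v0 + η • perp e), s * dot (perp e) (v0 + η • perp e))
    (s * dot e (v0 + -(η • perp e)), s * dot (perp e) (v0 + -(η • perp e)))
    (hrb e he _ m1) (hrb _ (perp_unit he) _ m1) (hrb e he _ m2) (hrb _ (perp_unit he) _ m2)
    (hVV _ m1) (hVV _ m2) ?_ (6 * r * (c * s)) (by positivity) ?_ ℓ1 h1 ?_ ?_ ?_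
  · intro k hk
    rw [himg]
    rintro _ ⟨z, hz, rfl⟩ _ ⟨z', hz', rfl⟩ hzz
    exact hthin k hk z hz z' hz' hzz
  · intro k hk
    rw [himg]
    have hk' : (k:ℝ) ≤ N := by exact_mod_cast hk
    have hdisp : ∀ z, |dot e ((F ^ (s * k)) z) - dot e z| ≤ 2 * (c * s) * N := by
      intro z
      rw [← dot_sub]
      have h1 := dot_unit_le he ((F ^ (s * k)) z - z)
      have h2 := disp_pow hc (s * k) z
      push_cast at h2
      have : c * s * k ≤ c * s * N := by gcongr
      linarith
    have hcsN : c * s ≤ c * s * N := by nlinarith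
    refine ⟨_, ⟨z1, hz1, rfl⟩, _, ⟨z2, hz2, rfl⟩, ?_, ?_⟩
    · simp only [ρ1]
      have := abs_le.1 (hdisp z1)
      nlinarith
    · simp only [ρ1]
      have := abs_le.1 (hdisp z2)
      nlinarith
  · simp only [dot_add, dot_smul, dn, dd1]; ring
  · rw [hNr]
    have : 0 ≤ (r:ℝ)^2 := by positivity
    nlinarith [mul_le_mul hcs hcs (by norm_num) (by positivity)]
  · linarith
  · rw [himg]
    rintro _ ⟨z, hz, rfl⟩ _ ⟨z', hz', rfl⟩ hzz
    exact hthin1 z hz z' hz' hzz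
  · simp only [dot_add, dot_smul, dn, dd2]
    nlinarith

lemma pow_commute_symm (F : R2 ≃ₜ R2) (n t : ℕ) (w : R2) :
    (F ^ n).symm ((F ^ t) w) = (F ^ t) ((F ^ n).symm w) := by
  rw [Homeomorph.symm_apply_eq, ← Homeomorph.mul_apply, ← pow_add, add_comm, pow_add,
    Homeomorph.mul_apply, Homeomorph.apply_symm_apply]

lemma pow_commute (F : R2 ≃ₜ R2) (n t : ℕ) (w : R2) :
    (F ^ n) ((F ^ t) w) = (F ^ t) ((F ^ n) w) := by
  rw [← Homeomorph.mul_apply, ← pow_add, add_comm, pow_add, Homeomorph.mul_apply]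

lemma spread {F : R2 ≃ₜ R2} {c : ℝ} (hc : ∀ z, ‖F z - z‖ ≤ c)
    (e : R2) (he : e.1 ^ 2 + e.2 ^ 2 = 1) (v0 : R2) (η : ℝ) (K : Set R2) (D : ℝ) (n : ℕ) (hn : 1 ≤ n)
    (hD0 : ∀ z ∈ K, ∀ w ∈ K, ‖z - w‖ ≤ D)
    (hD1 : ∀ z ∈ K, ∀ w ∈ K, ‖(F ^ n) z - (F ^ n) w‖ ≤ D)
    (hD2 : ∀ z ∈ K, ∀ w ∈ K, ‖(F ^ n).symm z - (F ^ n).symm w‖ ≤ D)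
    (x : R2) (hx : x ∈ K)
    (ha : dot e ((n:ℝ)⁻¹ • ((F ^ n) x - x) - v0) ≤ η / 2)
    (hb : dot e ((n:ℝ)⁻¹ • (x - (F ^ n).symm x) - v0) ≤ η / 2)
    (t : ℕ) (z w : R2) (hz : z ∈ K) (hw : w ∈ K) :
    dot e ((F ^ t) z) - dot e ((F ^ n).symm ((F ^ t) w)) ≤ 4 * c * t + 4 * D + n * (dot e v0 + η / 2) ∧
    dot e ((F ^ n) ((F ^ t) w)) - dot e ((F ^ t) z) ≤ 4 * c * t + 4 * D + n * (dot e v0 + η / 2) := by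
  have hn' : (0:ℝ) < n := by exact_mod_cast hn
  have du : ∀ y y' : R2, ∀ b, ‖y - y'‖ ≤ b → -(2 * b) ≤ dot e y - dot e y' ∧ dot e y - dot e y' ≤ 2 * b := by
    intro y y' b hb
    have h1 := dot_unit_le he (y - y')
    rw [dot_sub, abs_le] at h1
    constructor <;> linarith
  have ha' : dot e ((F ^ n) x) - dot e x ≤ n * (dot e v0 + η / 2) := by
    rw [dot_sub, dot_smul, dot_sub] at ha
    have : (n:ℝ)⁻¹ * (dot e ((F ^ n) x) - dot e x) ≤ dot e v0 + η / 2 := by linarith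
    rwa [inv_mul_le_iff₀ hn'] at this
  have hb' : dot e x - dot e ((F ^ n).symm x) ≤ n * (dot e v0 + η / 2) := by
    rw [dot_sub, dot_smul, dot_sub] at hb
    have : (n:ℝ)⁻¹ * (dot e x - dot e ((F ^ n).symm x)) ≤ dot e v0 + η / 2 := by linarith
    rwa [inv_mul_le_iff₀ hn'] at this
  have k1 := du _ _ _ (disp_pow hc t z)
  have k2 := du _ _ _ (hD0 z hz x hx)
  constructor
  · rw [pow_commute_symm]
    have k3 := du _ _ _ (hD2 x hx w hw)
    have k4 := du _ _ _ (disp_pow hc t ((F ^ n).symm w))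
    linarith
  · rw [pow_commute]
    have k3 := du _ _ _ (hD1 w hw x hx)
    have k4 := du _ _ _ (disp_pow hc t ((F ^ n) w))
    linarith

lemma core_step {F : R2 ≃ₜ R2} (hF : LatComm F) {c : ℝ} (hc1 : 1 ≤ c) (hc : ∀ z, ‖F z - z‖ ≤ c)
    (e : R2) (he : e.1 ^ 2 + e.2 ^ 2 = 1) (v0 : R2) (η : ℝ) (hη : 0 < η)
    (hball : ∀ w, nrm w ≤ η → v0 + w ∈ rotSet F)
    (K : Set R2) (hKc : IsCompact K) (hK : IsPreconnected K)
    (D : ℝ) (n : ℕ) (hn : 1 ≤ n)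
    (hD0 : ∀ z ∈ K, ∀ w ∈ K, ‖z - w‖ ≤ D)
    (hD1 : ∀ z ∈ K, ∀ w ∈ K, ‖(F ^ n) z - (F ^ n) w‖ ≤ D)
    (hD2 : ∀ z ∈ K, ∀ w ∈ K, ‖(F ^ n).symm z - (F ^ n).symm w‖ ≤ D)
    (x : R2) (hx : x ∈ K)
    (ha : dot e ((n:ℝ)⁻¹ • ((F ^ n) x - x) - v0) ≤ η / 2)
    (hb : dot e ((n:ℝ)⁻¹ • (x - (F ^ n).symm x) - v0) ≤ η / 2)
    (q u : R2) (R ε T : ℝ) (hT0 : 0 ≤ T) (hTdef : T = R + 2 * ε)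
    (hu : u ∈ rotSet F) (huq : u = q + R • e)
    (hT : ∀ z, nrm ((n:ℝ)⁻¹ • ((F ^ n) z - z) - q) ≤ T)
    (hlow : dot e v0 + η ≤ dot e q + T)
    (l0 θ0 l1 θ1 : ℝ) (hθ0 : 0 ≤ θ0) (hlθ0 : 2 * T * l0 ≤ θ0 ^ 2) (hl40 : 4 ≤ l0 * n)
    (hεn0 : 4 * ε * n + 1 ≤ l0 * n / 4) (hl0 : l0 ≤ η / 4)
    (hθ1 : 0 ≤ θ1) (hlθ1 : 2 * T * l1 ≤ θ1 ^ 2) (hl41 : 4 ≤ l1 * n)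
    (hεn1 : 4 * ε * n + 1 ≤ l1 * n / 4) (hl1 : l1 ≤ η / 4)
    (r s N : ℕ) (hr : 1 ≤ r) (hs : 1 ≤ s) (hN : N = r ^ 2)
    (ht : 4 * c * (s * N) ≤ η * n / 16) (hDn : 4 * D ≤ η * n / 25) (hηn : 16 ≤ η * n)
    (ω : ℝ) (z1 z2 : R2) (hz1 : z1 ∈ K) (hz2 : z2 ∈ K) (hω : ω * n ≤ dot e z2 - dot e z1)
    (hwid : 6 * c * N * s + 2 ≤ ω * n / 2) (hQ : 12 * r * c * s ≤ l1 * n / 4)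
    (hbig : (4 * (θ1 * n) + 4) + 12 * r * c * s + 2 * N * (2 * (4 * (θ0 * n) + 4) + 5)
      < 2 * η * (N * s)) : False := by
  have hn' : (0:ℝ) < n := by exact_mod_cast hn
  have thin : ∀ l θ : ℝ, 0 ≤ θ → 2 * T * l ≤ θ ^ 2 → 4 ≤ l * n → 4 * ε * n + 1 ≤ l * n / 4 →
      l ≤ η / 4 → ∀ k ≤ N, ∀ z ∈ K, ∀ z' ∈ K,
      |dot e ((F ^ (s * k)) z) - dot e ((F ^ (s * k)) z')| ≤ l * n / 4 →
      dot (perp e) ((F ^ (s * k)) z') - dot (perp e) ((F ^ (s * k)) z) ≤ 4 * (θ * n) + 4 := by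
    intro l θ h1 h2 h3 h4 h5 k hk z hz z' hz' hzz
    have hk' : (k:ℝ) ≤ N := by exact_mod_cast hk
    have hbd : 4 * c * ((s * k : ℕ) : ℝ) + 4 * D + n * (dot e v0 + η / 2)
        < n * (dot e q + T) - l * n / 4 - 1 := by
      push_cast
      have e1 : 4 * c * (s * k) ≤ 4 * c * ((s:ℝ) * N) := by gcongr
      have e2 : n * (dot e v0 + η) ≤ n * (dot e q + T) := by gcongr
      have e3 : l * n ≤ η / 4 * n := by gcongr
      linarith
    refine thin_rot hF hc e he q u R ε T hT0 hTdef hu huq n hn hT l θ h1 h2 h3 h4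
      ((F ^ (s * k)) '' K) (hKc.image (F ^ (s * k)).continuous)
      (hK.image _ (F ^ (s * k)).continuous.continuousOn) ?_ ?_ _ _ ⟨z, hz, rfl⟩ ⟨z', hz', rfl⟩ hzz
    · rintro _ ⟨y, hy, rfl⟩ _ ⟨w, hw, rfl⟩
      exact lt_of_le_of_lt
        (spread hc e he v0 η K D n hn hD0 hD1 hD2 x hx ha hb (s * k) y w hy hw).1 hbd
    · rintro _ ⟨y, hy, rfl⟩ _ ⟨w, hw, rfl⟩
      exact lt_of_le_of_lt
        (spread hc e he v0 η K D n hn hD0 hD1 hD2 x hx ha hb (s * k) y w hy hw).2 hbd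
  have hdc : Continuous (dot e) := by unfold dot; fun_prop
  have hωn : 0 < ω * n := by
    have : 0 ≤ 6 * c * N * s := by positivity
    linarith
  obtain ⟨z0, hz0, hmid⟩ := hK.intermediate_value hz1 hz2 hdc.continuousOn
    (show (dot e z1 + dot e z2) / 2 ∈ Icc (dot e z1) (dot e z2) by
      constructor <;> linarith)
  exact final_rot hF hc1 hc e he v0 η hη hball K hKc hK r s N hr hs hN (4 * (θ0 * n) + 4) (l1 * n / 4)
    (4 * (θ1 * n) + 4)
    (fun k hk z hz z' hz' hzz => thin l0 θ0 hθ0 hlθ0 hl40 hεn0 hl0 k hk z hz z' hz' (hzz.trans (by linarith)))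
    z0 z1 z2 hz0 hz1 hz2 (by linarith) (by linarith) hQ
    (thin l1 θ1 hθ1 hlθ1 hl41 hεn1 hl1 N le_rfl) hbig

set_option maxHeartbeats 2000000 in
lemma params (c η ω Tm : ℝ) (hc : 1 ≤ c) (hη : 0 < η) (hω : 0 < ω) (hωη : 4 * ω ≤ η)
    (hTm : 1 ≤ Tm) :
    ∃ (l0 θ0 l1 θ1 ε nm : ℝ) (r : ℕ), 0 ≤ θ0 ∧ 2 * Tm * l0 ≤ θ0 ^ 2 ∧ l0 ≤ η / 4 ∧
      0 ≤ θ1 ∧ 2 * Tm * l1 ≤ θ1 ^ 2 ∧ l1 ≤ η / 4 ∧ 0 < l0 ∧ 0 < l1 ∧ 0 < ε ∧ ε ≤ 1 / 2 ∧ 1 ≤ r ∧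
      ∀ n : ℕ, nm ≤ n → ∃ s : ℕ, 1 ≤ s ∧ 4 ≤ l0 * n ∧ 4 * ε * n + 1 ≤ l0 * n / 4 ∧
        4 ≤ l1 * n ∧ 4 * ε * n + 1 ≤ l1 * n / 4 ∧
        4 * c * (s * ((r ^ 2 : ℕ) : ℝ)) ≤ η * n / 16 ∧ 16 ≤ η * n ∧
        6 * c * ((r ^ 2 : ℕ) : ℝ) * s + 2 ≤ ω * n / 2 ∧ 12 * r * c * s ≤ l1 * n / 4 ∧
        (4 * (θ1 * n) + 4) + 12 * r * c * s + 2 * ((r ^ 2 : ℕ) : ℝ) * (2 * (4 * (θ0 * n) + 4) + 5)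
          < 2 * η * (((r ^ 2 : ℕ) : ℝ) * s) := by
  have hc0 : 0 < c := by linarith
  obtain ⟨θ1, hθ1⟩ : ∃ t, t = η * ω / (512 * c) := ⟨_, rfl⟩
  have hθ1p : 0 < θ1 := by rw [hθ1]; positivity
  obtain ⟨l1, hl1⟩ : ∃ t, t = min (θ1 ^ 2 / (2 * Tm)) (η / 4) := ⟨_, rfl⟩
  have hl1p : 0 < l1 := by rw [hl1]; positivity
  obtain ⟨r, hr⟩ := exists_nat_ge (1 + 3 * ω / l1 + 24 * c / η)
  have p1 : 0 < 3 * ω / l1 := by positivity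
  have p2 : 0 < 24 * c / η := by positivity
  have hr1 : (1:ℝ) ≤ r := by linarith
  have hr2 : 3 * ω ≤ r * l1 := by
    rw [← div_le_iff₀ hl1p]; linarith
  have hr3 : 24 * c ≤ r * η := by
    rw [← div_le_iff₀ hη]; linarith
  obtain ⟨N, hN⟩ : ∃ t : ℝ, t = (r:ℝ) ^ 2 := ⟨_, rfl⟩
  have hN1 : 1 ≤ N := by rw [hN]; nlinarith
  obtain ⟨θ0, hθ0⟩ : ∃ t, t = η * ω / (2048 * c * N) := ⟨_, rfl⟩
  have hθ0p : 0 < θ0 := by rw [hθ0]; positivity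
  obtain ⟨l0, hl0⟩ : ∃ t, t = min (θ0 ^ 2 / (2 * Tm)) (η / 4) := ⟨_, rfl⟩
  have hl0p : 0 < l0 := by rw [hl0]; positivity
  obtain ⟨ε, hε⟩ : ∃ t, t = min (min (l0 / 32) (l1 / 32)) (1 / 2) := ⟨_, rfl⟩
  have hεp : 0 < ε := by rw [hε]; positivity
  have hε0 : ε ≤ l0 / 32 := by rw [hε]; exact (min_le_left _ _).trans (min_le_left _ _)
  have hε1 : ε ≤ l1 / 32 := by rw [hε]; exact (min_le_left _ _).trans (min_le_right _ _)
  have hε2 : ε ≤ 1 / 2 := by rw [hε]; exact min_le_right _ _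
  refine ⟨l0, θ0, l1, θ1, ε, 8 / l0 + 8 / l1 + 16 / ω + 16 * c * N / ω + 1000 * c * N / (η * ω)
    + 16 / η, r, hθ0p.le, ?_, ?_, hθ1p.le, ?_, ?_, hl0p, hl1p, hεp, hε2, by exact_mod_cast hr1, ?_⟩
  · have : l0 ≤ θ0 ^ 2 / (2 * Tm) := by rw [hl0]; exact min_le_left _ _
    rw [le_div_iff₀ (by positivity)] at this; linarith
  · rw [hl0]; exact min_le_right _ _
  · have : l1 ≤ θ1 ^ 2 / (2 * Tm) := by rw [hl1]; exact min_le_left _ _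
    rw [le_div_iff₀ (by positivity)] at this; linarith
  · rw [hl1]; exact min_le_right _ _
  push_cast
  rw [← hN]
  intro n hn
  have q1 : 0 < 8 / l0 := by positivity
  have q2 : 0 < 8 / l1 := by positivity
  have q3 : 0 < 16 / ω := by positivity
  have q4 : 0 < 16 * c * N / ω := by positivity
  have q5 : 0 < 1000 * c * N / (η * ω) := by positivity
  have q6 : 0 < 16 / η := by positivity
  have n1 : 8 ≤ n * l0 := by rw [← div_le_iff₀ hl0p]; linarith
  have n2 : 8 ≤ n * l1 := by rw [← div_le_iff₀ hl1p]; linarith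
  have n3 : 16 ≤ n * ω := by rw [← div_le_iff₀ hω]; linarith
  have n4 : 16 * c * N ≤ n * ω := by rw [← div_le_iff₀ hω]; linarith
  have n5 : 1000 * c * N ≤ n * (η * ω) := by rw [← div_le_iff₀ (by positivity)]; linarith
  have n6 : 16 ≤ n * η := by rw [← div_le_iff₀ hη]; linarith
  have hn0 : (0:ℝ) ≤ n := Nat.cast_nonneg n
  obtain ⟨y, hy⟩ : ∃ t, t = n * ω / (16 * c * N) := ⟨_, rfl⟩
  have hcN : 0 < 16 * c * N := by positivity
  have hy1 : 1 ≤ y := by rw [hy, le_div_iff₀ hcN]; linarith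
  have hyn : y * (16 * c * N) = n * ω := by rw [hy]; field_simp
  have hs1 : 1 ≤ ⌊y⌋₊ := by rw [Nat.one_le_floor_iff]; exact hy1
  have hsy : (⌊y⌋₊ : ℝ) ≤ y := Nat.floor_le (by linarith)
  have hys : y < ⌊y⌋₊ + 1 := Nat.lt_floor_add_one y
  refine ⟨⌊y⌋₊, hs1, ?_⟩
  have hs1' : (1:ℝ) ≤ ⌊y⌋₊ := by exact_mod_cast hs1
  generalize (⌊y⌋₊ : ℝ) = s at *
  have u1 : s * (16 * c * N) ≤ n * ω := by rw [← hyn]; gcongr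
  have u2 : n * ω ≤ s * (32 * c * N) := by 
    have h2 : y ≤ 2 * s := by linarith
    have h3 : y * (16 * c * N) ≤ 2 * s * (16 * c * N) := by gcongr
    linarith
  have u3 : ε * n ≤ l0 / 32 * n := by gcongr
  have u4 : ε * n ≤ l1 / 32 * n := by gcongr
  have u5 : 4 * ω * n ≤ η * n := by gcongr
  have v2 : θ1 * (512 * c) = η * ω := by rw [hθ1]; field_simp
  have v3 : θ0 * (2048 * c * N) = η * ω := by rw [hθ0]; field_simp
  refine ⟨by linarith, by linarith, by linarith, by linarith, by linarith, by linarith,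
    by linarith, ?_, ?_⟩
  · have : 12 * c * s * r ^ 2 ≤ r * l1 * n / 4 := by
      rw [← hN]
      have : 3 * ω * n ≤ r * l1 * n := by gcongr
      linarith
    have h2 : r * (12 * r * c * s) ≤ r * (l1 * n / 4) := by linarith
    exact le_of_mul_le_mul_left h2 (by linarith)
  · have w0 : η * (n * ω) ≤ η * (s * (32 * c * N)) := by gcongr
    have w1 : θ1 * n * 16 ≤ η * (N * s) := by
      have : c * (θ1 * n * 16) ≤ c * (η * (N * s)) := by
        have : θ1 * (512 * c) * n = η * ω * n := by rw [v2]
        linarith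
      exact le_of_mul_le_mul_left this hc0
    have w2 : N * (θ0 * n) * 64 ≤ η * (N * s) := by
      have : c * (N * (θ0 * n) * 64) ≤ c * (η * (N * s)) := by
        have : θ0 * (2048 * c * N) * n = η * ω * n := by rw [v3]
        linarith
      exact le_of_mul_le_mul_left this hc0
    have w3 : 24 * c * (r * s) ≤ r * η * (r * s) := by gcongr
    have w4 : r * η * (r * s) = η * (N * s) := by rw [hN]; ring
    have w5 : 31 * N ≤ η * (N * s) := by
      have : c * (31 * N) ≤ c * (η * (N * s)) := by
        have : 0 ≤ c * N := by positivity
        linarith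
      exact le_of_mul_le_mul_left this hc0
    linarith

set_option maxHeartbeats 2000000 in
lemma core {F : R2 ≃ₜ R2} (hF : LatComm F) (hrot : (interior (rotSet F)).Nonempty) :
    ∃ M : ℝ, 0 < M ∧ ∀ D : ℝ, M ≤ D → ∀ K : Set R2, IsCompact K → IsPreconnected K →
      (∀ j : ℤ, ∀ z ∈ K, ∀ w ∈ K, ‖(F ^ j) z - (F ^ j) w‖ ≤ D) →
      ∀ z ∈ K, ∀ w ∈ K, ‖z - w‖ ≤ D / 2 := by
  obtain ⟨c, hc1, hc⟩ := disp_bdd hF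
  have hc0 : 0 < c := by linarith
  obtain ⟨v0, hv0⟩ := hrot
  obtain ⟨η', hη', hb'⟩ := Metric.isOpen_iff.1 isOpen_interior v0 hv0
  obtain ⟨η, hηd⟩ : ∃ t, t = min (η' / 2) 1 := ⟨_, rfl⟩
  have hη : 0 < η := by rw [hηd]; positivity
  have hη1 : η ≤ 1 := by rw [hηd]; exact min_le_right _ _
  have hη2 : η < η' := by
    have : η ≤ η' / 2 := by rw [hηd]; exact min_le_left _ _
    linarith
  have hball : ∀ w, nrm w ≤ η → v0 + w ∈ rotSet F := fun w hw => by
    apply interior_subset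
    apply hb'
    rw [mem_ball, dist_eq_norm]
    have := norm_le_nrm w
    simp only [add_sub_cancel_left]
    linarith
  have hv0r : v0 ∈ rotSet F := interior_subset hv0
  have hv0c := rotSet_bdd hc v0 hv0r
  have hsub : ∀ v : R2, ‖v‖ ≤ c → nrm (v - v0) ≤ 4 * c := fun v hv => by
    have h1 := nrm_le_norm (v - v0)
    have h2 := norm_sub_le v v0
    linarith
  obtain ⟨κ, Rm, hκ, hκ1, hRm, hsel⟩ := selection (rotSet F) v0 (4 * c) η (by linarith) hη
    (by linarith) ⟨v0, hv0r⟩ (fun v hv => hsub v (rotSet_bdd hc v hv))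
  obtain ⟨l0, θ0, l1, θ1, ε, nm, r, hθ0, hl0, hl0η, hθ1, hl1, hl1η, hl0p, hl1p, hε, hε2, hr, hpar⟩ :=
    params c η (κ * η / 400) (Rm + 1) hc1 hη (by positivity)
      (by have : κ * η ≤ 1 * η := by gcongr
          linarith) (by linarith)
  obtain ⟨N0, hN0⟩ := rot_close hc (ε / 2) (by positivity)
  refine ⟨η * (1 + N0 + |nm|), by positivity, fun D hD K hKc hK hdiam z hz w hw => ?_⟩
  by_contra hcon
  push Not at hcon
  have hDp : 0 < D := lt_of_lt_of_le (by positivity) hD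
  have hn1 := Nat.le_ceil (100 * D / η)
  have hn2 := Nat.ceil_lt_add_one (a := 100 * D / η) (by positivity)
  generalize ⌈100 * D / η⌉₊ = n at hn1 hn2
  rw [div_le_iff₀ hη] at hn1
  have hη3 : η ≤ D := by
    have : η * 1 ≤ η * (1 + N0 + |nm|) := by
      gcongr
      have := abs_nonneg nm
      have : (0:ℝ) ≤ N0 := Nat.cast_nonneg _
      linarith
    linarith
  have hn3 : n * η ≤ 200 * D := by
    have : (n:ℝ) * η < (100 * D / η + 1) * η := by gcongr
    have e : (100 * D / η + 1) * η = 100 * D + η := by field_simp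
    linarith
  have hnbig : 1 + N0 + |nm| ≤ (n:ℝ) := by
    have : (1 + N0 + |nm|) * η ≤ n * η := by linarith
    exact le_of_mul_le_mul_right this hη
  have habs := abs_nonneg nm
  have hN0p : (0:ℝ) ≤ N0 := Nat.cast_nonneg _
  have hnN0 : N0 ≤ n := by
    have : (N0:ℝ) ≤ n := by linarith
    exact_mod_cast this
  have hn1' : 1 ≤ n := by
    have : (1:ℝ) ≤ n := by linarith
    exact_mod_cast this
  have hnp : (0:ℝ) < n := by exact_mod_cast hn1'
  obtain ⟨s, hs, i1, i2, i3, i4, i5, i6, i7, i8, i9⟩ := hpar n (by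
    have := le_abs_self nm
    linarith)
  have hdisp : ∀ x, ‖(n:ℝ)⁻¹ • ((F ^ n) x - x)‖ ≤ c := fun x => by
    rw [norm_smul, norm_inv, Real.norm_natCast, inv_mul_le_iff₀ hnp]
    linarith [disp_pow hc n x]
  obtain ⟨q, e, u, R, hu, he, hR, hRRm, huq, hPq, ha, hb, hd⟩ :=
    hsel ((n:ℝ)⁻¹ • ((F ^ n) z - z) - v0) ((n:ℝ)⁻¹ • (z - (F ^ n).symm z) - v0) (z - w)
      (hsub _ (hdisp z)) (hsub _ (by
        have := hdisp ((F ^ n).symm z)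
        rwa [Homeomorph.apply_symm_apply] at this)) ε hε
  have hωn : κ * η / 400 * n ≤ |dot e (z - w)| := by
    have h1 := norm_le_nrm (z - w)
    have h2 : κ * (D / 2) ≤ κ * nrm (z - w) := by
      gcongr
      linarith
    have h3 : κ * (n * η) ≤ κ * (200 * D) := by gcongr
    linarith
  have hT : ∀ x, nrm ((n:ℝ)⁻¹ • ((F ^ n) x - x) - q) ≤ R + 2 * ε := fun x => by
    obtain ⟨v, hv, hvx⟩ := hN0 n hnN0 x
    have h1 := hPq v hv
    have h2 := nrm_le_norm ((n:ℝ)⁻¹ • ((F ^ n) x - x) - v)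
    have h3 := nrm_add ((n:ℝ)⁻¹ • ((F ^ n) x - x) - v) (v - q)
    rw [sub_add_sub_cancel] at h3
    linarith
  have hne : nrm e = 1 := by
    have := nrm_sq e
    rw [he] at this
    exact (pow_eq_one_iff_of_nonneg (nrm_nonneg e) two_ne_zero).1 this
  have hlow : dot e v0 + η ≤ dot e q + (R + 2 * ε) := by
    have h1 := hPq (v0 + η • e) (hball _ (by rw [nrm_smul, hne, abs_of_pos hη, mul_one]))
    have h2 := (le_abs_self _).trans (dot_le e (v0 + η • e - q))
    rw [hne, one_mul, dot_sub, dot_add, dot_smul] at h2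
    have h3 : dot e e = 1 := by unfold dot; linarith
    rw [h3] at h2
    linarith
  have key : ∀ z1 ∈ K, ∀ z2 ∈ K, κ * η / 400 * n ≤ dot e z2 - dot e z1 → False := by
    intro z1 hz1 z2 hz2 hω
    refine core_step hF hc1 hc e he v0 η hη hball K hKc hK D n hn1' ?_ ?_ ?_ z hz ha hb q u R ε
      (R + 2 * ε) (by positivity) rfl hu huq hT hlow l0 θ0 l1 θ1 hθ0 ?_ i1 i2 hl0η hθ1 ?_ i3 i4 hl1η
      r s (r ^ 2) hr hs rfl i5 (by linarith) i6 (κ * η / 400) z1 z2 hz1 hz2 hω i7 i8 i9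
    · intro a ha b hb
      simpa using hdiam 0 a ha b hb
    · intro a ha b hb
      simpa using hdiam n a ha b hb
    · intro a ha b hb
      have := hdiam (-n) a ha b hb
      rw [zpow_neg, zpow_natCast] at this
      exact this
    · refine le_trans ?_ hl0
      gcongr
      linarith
    · refine le_trans ?_ hl1
      gcongr
      linarith
  rw [dot_sub] at hωn
  rcases le_abs.1 hωn with h | h
  · exact key w hw z hz h
  · exact key z hz w hw (by linarith)

/-- **Theorem C.** If the rotation set has nonempty interior, there is a uniform bound `M`
such that every continuum of diameter greater than `M` is dynamically unbounded. -/
theorem large_continua_dynamically_unbounded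
    (f : Torus ≃ₜ Torus) (F : R2 ≃ₜ R2) (hF : IsLiftFun ⇑f ⇑F)
    (hrot : (interior (rotSet F)).Nonempty) :
    ∃ M : ℝ, 0 < M ∧ ∀ K : Set R2, IsContinuum K →
      ENNReal.ofReal M < EMetric.diam K → dynDiam F K = ⊤ := by
  obtain ⟨M, hM, hcore⟩ := core (F := F) hF.2 hrot
  refine ⟨M, hM, fun K hK hdiam => ?_⟩
  by_contra htop
  have hle : ∀ j : ℤ, Metric.ediam (iterZ F j '' K) ≤ dynDiam F K := fun j =>
    le_iSup (fun j : ℤ => Metric.ediam (iterZ F j '' K)) j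
  obtain ⟨D, hD⟩ : ∃ D, D = (dynDiam F K).toReal := ⟨_, rfl⟩
  have hDd : dynDiam F K = ENNReal.ofReal D := by rw [hD, ENNReal.ofReal_toReal htop]
  have hMD : M ≤ D := by
    have h0 := hle 0
    have hid : iterZ F 0 = id := rfl
    rw [hid, image_id, hDd] at h0
    have h1 : ENNReal.ofReal M < ENNReal.ofReal D := lt_of_lt_of_le hdiam h0
    exact ((ENNReal.ofReal_lt_ofReal_iff_of_nonneg hM.le).1 h1).le
  have hDp : 0 < D := by linarith
  have hbd : ∀ j : ℤ, ∀ z ∈ K, ∀ w ∈ K, ‖(F ^ j) z - (F ^ j) w‖ ≤ D := by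
    intro j z hz w hw
    have h1 := (Metric.edist_le_ediam_of_mem (mem_image_of_mem (iterZ F j) hz)
      (mem_image_of_mem (iterZ F j) hw)).trans (hle j)
    rw [iterZ_eq, hDd, edist_le_ofReal hDp.le, dist_eq_norm] at h1
    exact h1
  have hhalf : dynDiam F K ≤ ENNReal.ofReal (D / 2) := by
    refine iSup_le fun j => Metric.ediam_le ?_
    rintro _ ⟨z, hz, rfl⟩ _ ⟨w, hw, rfl⟩
    rw [iterZ_eq, edist_le_ofReal (by positivity), dist_eq_norm]
    refine hcore D hMD ((F ^ j) '' K) (hK.1.image (F ^ j).continuous)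
      (hK.2.isPreconnected.image _ (F ^ j).continuous.continuousOn) ?_ _
      (mem_image_of_mem _ hz) _ (mem_image_of_mem _ hw)
    rintro i _ ⟨a, ha, rfl⟩ _ ⟨b, hb, rfl⟩
    rw [← Homeomorph.mul_apply, ← Homeomorph.mul_apply, ← zpow_add]
    exact hbd _ a ha b hb
  rw [hDd, ENNReal.ofReal_le_ofReal_iff (by positivity)] at hhalf
  linarith
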